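/- Fix p ∈ (1,∞) and let ι^{(n)} := n^{−1/2}(1,1,…,1) ∈ S^{n−1}, ι := (ι^{(n)})_{n∈ℕ}. Then (W_ι^{(n,p)})_{n∈ℕ} satisfies a large deviation principle with speed n and the quasiconvex, symmetric, good rate function 𝕀^{cr}_p(w) := inf{Λ_p*(τ₁,τ₂) : τ₁ ∈ ℝ, τ₂ > 0, τ₁ τ₂^{−1/p} = w}. Moreover, for every w ∈ (−1,1): (1) if p > 2 then 𝕀^q_{p,μ₂}(w) ≥ 𝕀^{cr}_p(w), with equality if and only if w = 0; (2) if p = 2 then 𝕀^q_{2,μ₂}(w) = 𝕀^{cr}_2(w); (3) if p < 2 then 𝕀^q_{p,μ₂}(w) ≤ 𝕀^{cr}_p(w), with equality if and only if w = 0. -/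

import Mathlib

open MeasureTheory Filter Topology Set ProbabilityTheory
open scoped ENNReal NNReal

noncomputable section

namespace LDP

/-- The nonnegative part of an extended real, as an extended nonnegative real. -/
def erealToENNReal (x : EReal) : ℝ≥0∞ := if x = ⊤ then ⊤ else ENNReal.ofReal x.toReal

/-- Extended (possibly infinite) integral of an `EReal`-valued function:
positive part minus negative part. -/
def eIntegral (ν : Measure ℝ) (f : ℝ → EReal) : EReal :=
  ((∫⁻ u, erealToENNReal (f u) ∂ν : ℝ≥0∞) : EReal)
    - ((∫⁻ u, erealToENNReal (-f u) ∂ν : ℝ≥0∞) : EReal)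

/-- `q`-th absolute moment of a measure on `ℝ`. -/
def mom (q : ℝ) (ν : Measure ℝ) : ℝ≥0∞ := ∫⁻ x, ENNReal.ofReal (|x| ^ q) ∂ν

open Classical in
/-- Relative entropy `H(ν|μ)`. -/
def relEnt (ν μ : Measure ℝ) : EReal :=
  if ν ≪ μ then eIntegral ν (fun x => ENNReal.log (ν.rnDeriv μ x)) else ⊤

/-- The generalized normal distribution `μ_p` on `ℝ`. -/
def muP (p : ℝ) : Measure ℝ :=
  volume.withDensity fun y =>
    ENNReal.ofReal ((2 * p ^ (1/p) * Real.Gamma (1 + 1/p))⁻¹ * Real.exp (-(|y| ^ p) / p))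

/-- The uniform probability measure `μ_∞` on `[-1,1]`. -/
def muInf : Measure ℝ := (volume (Icc (-1:ℝ) 1))⁻¹ • volume.restrict (Icc (-1:ℝ) 1)

/-- Extended-real-valued log moment generating function of a measure on `ℝ`. -/
def logM (γ : Measure ℝ) (t : ℝ) : EReal :=
  ENNReal.log (∫⁻ y, ENNReal.ofReal (Real.exp (t * y)) ∂γ)

/-- The class `𝒯_q` of measures whose log mgf is dominated by `C|t|^{q/(q-1)} + C`. -/
def memT (q : ℝ) (γ : Measure ℝ) : Prop :=
  ∃ C : ℝ, ∀ t : ℝ, logM γ t ≤ ((C * |t| ^ (q/(q-1)) + C : ℝ) : EReal)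

/-- Legendre transform of a function of one real variable. -/
def legendre1 (Λ : ℝ → EReal) (τ : ℝ) : EReal := ⨆ t : ℝ, ((t * τ : ℝ) : EReal) - Λ t

/-- Legendre transform of a function of two real variables. -/
def legendre2 (Λ : ℝ × ℝ → EReal) (τ : ℝ × ℝ) : EReal :=
  ⨆ t : ℝ × ℝ, ((t.1 * τ.1 + t.2 * τ.2 : ℝ) : EReal) - Λ t

/-- Legendre transform of a function of three real variables. -/
def legendre3 (Λ : ℝ × ℝ × ℝ → EReal) (τ : ℝ × ℝ × ℝ) : EReal :=
  ⨆ t : ℝ × ℝ × ℝ, ((t.1 * τ.1 + t.2.1 * τ.2.1 + t.2.2 * τ.2.2 : ℝ) : EReal) - Λ t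

/-- `Φ_p(t₀,t₁,t₂) = log ∫∫ exp(t₀ z² + t₁ z y + t₂ |y|^p) μ₂(dz) μ_p(dy)`. -/
def Phi (p : ℝ) (t : ℝ × ℝ × ℝ) : EReal :=
  ENNReal.log (∫⁻ y, (∫⁻ z,
    ENNReal.ofReal (Real.exp (t.1 * z^2 + t.2.1 * z * y + t.2.2 * |y| ^ p)) ∂(muP 2)) ∂(muP p))

/-- The annealed rate function `𝕀ᵃ_p` for `p ∈ [2,∞)`. -/
def Ia (p : ℝ) (w : ℝ) : EReal :=
  ⨅ τ ∈ {τ : ℝ × ℝ × ℝ | 0 < τ.1 ∧ 0 < τ.2.2 ∧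
      τ.1 ^ (-(1:ℝ)/2) * τ.2.1 * τ.2.2 ^ (-(1:ℝ)/p) = w},
    legendre3 (Phi p) τ

/-- `Λ_p(t₁,t₂) = log ∫ exp(t₁ y + t₂|y|^p) μ_p(dy)`. -/
def LamP (p : ℝ) (t : ℝ × ℝ) : EReal :=
  ENNReal.log (∫⁻ y, ENNReal.ofReal (Real.exp (t.1 * y + t.2 * |y| ^ p)) ∂(muP p))

/-- `Ψ_{p,ν}(t₁,t₂) = ∫ Λ_p(t₁ u, t₂) ν(du)`. -/
def Psi (p : ℝ) (ν : Measure ℝ) (t : ℝ × ℝ) : EReal :=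
  eIntegral ν (fun u => LamP p (t.1 * u, t.2))

/-- The quenched rate function `𝕀^q_{p,ν}`. -/
def Iq (p : ℝ) (ν : Measure ℝ) (w : ℝ) : EReal :=
  ⨅ τ ∈ {τ : ℝ × ℝ | 0 < τ.2 ∧ τ.1 * τ.2 ^ (-(1:ℝ)/p) = w}, legendre2 (Psi p ν) τ

/-- The Cramér-type rate function `𝕀^{cr}_p`. -/
def Icr (p : ℝ) (w : ℝ) : EReal :=
  ⨅ τ ∈ {τ : ℝ × ℝ | 0 < τ.2 ∧ τ.1 * τ.2 ^ (-(1:ℝ)/p) = w}, legendre2 (LamP p) τ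

/-- `Φ_γ(t₀,t₁) = log ∫∫ exp(t₀ z² + t₁ z x) μ₂(dz) γ(dx)`. -/
def Phig (γ : Measure ℝ) (t : ℝ × ℝ) : EReal :=
  ENNReal.log (∫⁻ x, (∫⁻ z,
    ENNReal.ofReal (Real.exp (t.1 * z^2 + t.2 * z * x)) ∂(muP 2)) ∂γ)

/-- The annealed rate function `𝕀ᵃ_γ` for a product measure `γ^{⊗n}`. -/
def Iag (γ : Measure ℝ) (w : ℝ) : EReal :=
  ⨅ τ ∈ {τ : ℝ × ℝ | 0 < τ.1 ∧ τ.1 ^ (-(1:ℝ)/2) * τ.2 = w}, legendre2 (Phig γ) τ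

/-- `Ψ_{γ,ν}(t) = ∫ log M_γ(t u) ν(du)`. -/
def Psig (γ ν : Measure ℝ) (t : ℝ) : EReal := eIntegral ν (fun u => logM γ (t * u))

/-- The quenched rate function `𝕀^q_{γ,ν}` for a product measure. -/
def Iqg (γ ν : Measure ℝ) : ℝ → EReal := legendre1 (Psig γ ν)

/-- `Ψ_{∞,ν}`. -/
def PsiInf (ν : Measure ℝ) : ℝ → EReal := Psig muInf ν

/-- `𝕀^q_{∞,ν}`. -/
def IqInf (ν : Measure ℝ) : ℝ → EReal := legendre1 (PsiInf ν)

/-- `𝕀ᵃ_∞`. -/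
def IaInf : ℝ → EReal := Iag muInf

/-- Euclidean inner product on `ℝⁿ`. -/
def dotp {n : ℕ} (x y : Fin n → ℝ) : ℝ := ∑ i, x i * y i

/-- The unit ℓ^p ball of `ℝⁿ`. -/
def lpBall (n : ℕ) (p : ℝ) : Set (Fin n → ℝ) := {x | ∑ i, |x i| ^ p ≤ 1}

/-- The uniform probability measure on the unit ℓ^p ball. -/
def uniformLpBall (n : ℕ) (p : ℝ) : Measure (Fin n → ℝ) :=
  (volume (lpBall n p))⁻¹ • volume.restrict (lpBall n p)

/-- The unit Euclidean sphere in `ℝⁿ`. -/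
def unitSphereSet (n : ℕ) : Set (Fin n → ℝ) := {x | ∑ i, (x i)^2 = 1}

/-- `μ` is the (unique) rotation-invariant probability measure on the unit sphere `S^{n-1}`. -/
def IsUniformSphere {n : ℕ} (μ : Measure (Fin n → ℝ)) : Prop :=
  IsProbabilityMeasure μ ∧ μ (unitSphereSet n) = 1 ∧
    ∀ O : Matrix.orthogonalGroup (Fin n) ℝ,
      Measure.map (fun x => (O : Matrix (Fin n) (Fin n) ℝ).mulVec x) μ = μ

/-- A large deviation principle with speed `s` and rate function `I`. -/
def IsLDP {Ω : Type*} [MeasurableSpace Ω] (P : Measure Ω)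
    (ξ : ℕ → Ω → ℝ) (s : ℕ → ℝ) (I : ℝ → EReal) : Prop :=
  LowerSemicontinuous I ∧
    ∀ Γ : Set ℝ, MeasurableSet Γ →
      (-(⨅ x ∈ interior Γ, I x) ≤
        atTop.liminf fun n =>
          (((s n)⁻¹ : ℝ) : EReal) * ENNReal.log (P {ω | ξ n ω ∈ interior Γ})) ∧
      ((atTop.limsup fun n =>
          (((s n)⁻¹ : ℝ) : EReal) * ENNReal.log (P {ω | ξ n ω ∈ closure Γ})) ≤
        -(⨅ x ∈ closure Γ, I x))

/-- Goodness of a rate function: compact sublevel sets. -/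
def HasCompactSublevels (I : ℝ → EReal) : Prop := ∀ c : ℝ, IsCompact {x | I x ≤ (c : EReal)}

/-- Quasiconvexity: convex sublevel sets. -/
def QuasiconvexRate (I : ℝ → EReal) : Prop := ∀ c : EReal, Convex ℝ {x | I x ≤ c}

/-- Symmetry: `I(-w) = I(w)`. -/
def SymmetricRate (I : ℝ → EReal) : Prop := ∀ w : ℝ, I (-w) = I w

/-- Convexity of an extended-real-valued rate function. -/
def ConvexRate (I : ℝ → EReal) : Prop :=
  ∀ x y a b : ℝ, 0 ≤ a → 0 ≤ b → a + b = 1 →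
    I (a * x + b * y) ≤ (a : EReal) * I x + (b : EReal) * I y

/-- Convexity on a set, for extended-real-valued functions. -/
def ConvexOnE (s : Set ℝ) (g : ℝ → EReal) : Prop :=
  ∀ x ∈ s, ∀ y ∈ s, ∀ a b : ℝ, 0 ≤ a → 0 ≤ b → a + b = 1 →
    g (a * x + b * y) ≤ (a : EReal) * g x + (b : EReal) * g y

/-- Concavity on a set, for extended-real-valued functions. -/
def ConcaveOnE (s : Set ℝ) (g : ℝ → EReal) : Prop :=
  ∀ x ∈ s, ∀ y ∈ s, ∀ a b : ℝ, 0 ≤ a → 0 ≤ b → a + b = 1 →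
    (a : EReal) * g x + (b : EReal) * g y ≤ g (a * x + b * y)

/-- Strict convexity, for extended-real-valued functions. -/
def StrictConvexE (g : ℝ → EReal) : Prop :=
  ∀ x y : ℝ, x ≠ y → ∀ a b : ℝ, 0 < a → 0 < b → a + b = 1 →
    g (a * x + b * y) < (a : EReal) * g x + (b : EReal) * g y

/-- The property of agreeing with a real affine function on a set. -/
def AffineOnE (s : Set ℝ) (g : ℝ → EReal) : Prop :=
  ∃ m q : ℝ, ∀ t ∈ s, g t = ((m * t + q : ℝ) : EReal)

/-- Empirical measure `L_{n,θ} = (1/n) Σ δ_{√n θ_i}`. -/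
def empMeas (n : ℕ) (θn : Fin n → ℝ) : Measure ℝ :=
  ((n : ℝ≥0∞))⁻¹ • ∑ i : Fin n, Measure.dirac (Real.sqrt n * θn i)

end LDP

open LDP

namespace LDP

lemma mul_le_mul_abs_rpow_add {p b : ℝ} (hp : 1 < p) (hb : 0 < b) (s y : ℝ) :
    s * y ≤ b * |y| ^ p + |s| * (|s| / b) ^ (1 / (p - 1)) := by
  have hp1 : 0 < p - 1 := by linarith
  have h0 : s * y ≤ |s| * |y| := by rw [← abs_mul]; exact le_abs_self _
  rcases le_or_gt |y| ((|s| / b) ^ (1 / (p - 1))) with h | h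
  · have : |s| * |y| ≤ |s| * (|s| / b) ^ (1 / (p - 1)) := by gcongr
    have : 0 ≤ b * |y| ^ p := by positivity
    linarith
  · have hy : 0 < |y| := lt_of_le_of_lt (by positivity) h
    have h1 : |s| / b ≤ |y| ^ (p - 1) := by
      have := Real.rpow_le_rpow (by positivity) h.le hp1.le
      rwa [← Real.rpow_mul (by positivity), one_div_mul_cancel hp1.ne', Real.rpow_one] at this
    have h2 : |s| * |y| ≤ b * |y| ^ p := by
      have h3 : |y| ^ p = |y| ^ (p - 1) * |y| := by
        rw [← Real.rpow_add_one hy.ne']; congr 1; ring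
      rw [h3, ← mul_assoc]
      gcongr
      rwa [div_le_iff₀' hb] at h1
    have : 0 ≤ |s| * (|s| / b) ^ (1 / (p - 1)) := by positivity
    linarith

lemma integrable_exp_neg_mul_abs_rpow {p b : ℝ} (hp : 1 < p) (hb : 0 < b) :
    Integrable (fun y : ℝ => Real.exp (-(b * |y| ^ p))) := by
  have h := integrableOn_rpow_mul_exp_neg_mul_rpow (p := p) (s := 0) (by norm_num)
    (by linarith) hb
  have h1 : IntegrableOn (fun y : ℝ => Real.exp (-(b * |y| ^ p))) (Ioi 0) := by
    refine h.congr_fun (fun x hx => ?_) measurableSet_Ioi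
    simp [abs_of_pos (show 0 < x from hx)]
  rw [← integrableOn_univ, ← Iic_union_Ioi (a := (0 : ℝ)), integrableOn_union]
  refine ⟨?_, h1⟩
  rw [← Measure.map_neg_eq_self (volume : Measure ℝ)]
  let m : MeasurableEmbedding fun x : ℝ => -x := (Homeomorph.neg ℝ).measurableEmbedding
  rw [m.integrableOn_map_iff]
  simp_rw [Function.comp_def, abs_neg, neg_preimage, neg_Iic, neg_zero]
  exact (integrableOn_Ici_iff_integrableOn_Ioi (by simp)).2 h1

lemma integrable_exp_lin {p b : ℝ} (hp : 1 < p) (hb : 0 < b) (s : ℝ) :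
    Integrable (fun y : ℝ => Real.exp (s * y - b * |y| ^ p)) := by
  refine Integrable.mono' (g := fun y : ℝ =>
      Real.exp (|s| * (|s| / (b / 2)) ^ (1 / (p - 1))) * Real.exp (-(b / 2 * |y| ^ p)))
    ((integrable_exp_neg_mul_abs_rpow hp (half_pos hb)).const_mul _)
    (by fun_prop) (ae_of_all _ fun y => ?_)
  rw [Real.norm_of_nonneg (Real.exp_pos _).le, ← Real.exp_add]
  have := mul_le_mul_abs_rpow_add hp (half_pos hb) s y
  gcongr
  linarith

/-- The normalising constant of `μ_p`. -/
def normZ (p : ℝ) : ℝ := 2 * p ^ (1 / p) * Real.Gamma (1 + 1 / p)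

lemma normZ_pos {p : ℝ} (hp : 1 < p) : 0 < normZ p := by
  have : 0 < Real.Gamma (1 + 1 / p) := Real.Gamma_pos_of_pos (by positivity)
  unfold normZ; positivity

lemma integral_exp_neg_abs_rpow_div {p : ℝ} (hp : 1 < p) :
    ∫ y : ℝ, Real.exp (-(|y| ^ p) / p) = normZ p := by
  have h0 : 0 < p := by linarith
  have h := integral_comp_abs (f := fun y : ℝ => Real.exp (-(y ^ p) / p))
  have h1 := integral_exp_neg_mul_rpow h0 (b := 1 / p) (by positivity)
  rw [h]
  have h2 : ∀ y : ℝ, -(y ^ p) / p = -(1 / p) * y ^ p := fun y => by ring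
  simp_rw [h2, h1]
  have h3 : (1 / p : ℝ) ^ (-1 / p) = p ^ (1 / p) := by
    rw [one_div, Real.inv_rpow h0.le, ← Real.rpow_neg h0.le]; congr 1; ring
  rw [h3, normZ, add_comm]; ring

/-- Density of `μ_p`. -/
def densP (p y : ℝ) : ℝ := (normZ p)⁻¹ * Real.exp (-(|y| ^ p) / p)

lemma densP_pos {p : ℝ} (hp : 1 < p) (y : ℝ) : 0 < densP p y := by
  have := normZ_pos hp
  unfold densP; positivity

lemma continuous_densP {p : ℝ} (hp : 1 < p) : Continuous (densP p) := by
  unfold densP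
  refine continuous_const.mul (Real.continuous_exp.comp ?_)
  exact ((continuous_abs.rpow_const (fun _ => Or.inr (by linarith))).neg).div_const _

lemma densP_neg (p y : ℝ) : densP p (-y) = densP p y := by simp [densP]

lemma muP_eq (p : ℝ) : muP p = volume.withDensity fun y => ENNReal.ofReal (densP p y) := rfl

lemma integral_muP {p : ℝ} (hp : 1 < p) (f : ℝ → ℝ) :
    ∫ y, f y ∂(muP p) = ∫ y, densP p y * f y := by
  rw [muP_eq, integral_withDensity_eq_integral_toReal_smul
    (continuous_densP hp).measurable.ennreal_ofReal (ae_of_all _ fun _ => ENNReal.ofReal_lt_top)]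
  simp [ENNReal.toReal_ofReal (densP_pos hp _).le]

lemma integrable_muP_iff {p : ℝ} (hp : 1 < p) {f : ℝ → ℝ} :
    Integrable f (muP p) ↔ Integrable (fun y => densP p y * f y) := by
  rw [muP_eq, integrable_withDensity_iff_integrable_smul'
    (continuous_densP hp).measurable.ennreal_ofReal (ae_of_all _ fun _ => ENNReal.ofReal_lt_top)]
  simp [ENNReal.toReal_ofReal (densP_pos hp _).le]

lemma integral_densP {p : ℝ} (hp : 1 < p) : ∫ y, densP p y = 1 := by
  unfold densP
  rw [integral_const_mul, integral_exp_neg_abs_rpow_div hp, inv_mul_cancel₀ (normZ_pos hp).ne']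

lemma integrable_densP {p : ℝ} (hp : 1 < p) : Integrable (densP p) := by
  unfold densP
  refine Integrable.const_mul ?_ _
  convert integrable_exp_neg_mul_abs_rpow hp (b := 1 / p) (by positivity) using 3
  ring

lemma isProbabilityMeasure_muP {p : ℝ} (hp : 1 < p) : IsProbabilityMeasure (muP p) := by
  constructor
  rw [muP_eq, withDensity_apply _ MeasurableSet.univ, Measure.restrict_univ,
    ← ofReal_integral_eq_lintegral_ofReal (integrable_densP hp)
      (ae_of_all _ fun y => (densP_pos hp y).le), integral_densP hp, ENNReal.ofReal_one]

lemma integrable_exp_muP {p : ℝ} (hp : 1 < p) (s : ℝ) :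
    Integrable (fun y => Real.exp (s * y)) (muP p) := by
  rw [integrable_muP_iff hp]
  unfold densP
  have := (integrable_exp_lin hp (b := 1 / p) (by positivity) s).const_mul (normZ p)⁻¹
  refine this.congr (ae_of_all _ fun y => ?_)
  simp only
  rw [mul_assoc, ← Real.exp_add]
  congr 2; ring

lemma mem_interior_muP {p : ℝ} (hp : 1 < p) (s : ℝ) :
    s ∈ interior (integrableExpSet id (muP p)) := by
  have : integrableExpSet id (muP p) = univ := eq_univ_of_forall fun t => integrable_exp_muP hp t
  simp [this]

lemma integrable_abs_rpow_exp_muP {p k : ℝ} (hp : 1 < p) (hk : 0 ≤ k) (s : ℝ) :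
    Integrable (fun y => |y| ^ k * Real.exp (s * y)) (muP p) := by
  simpa using integrable_rpow_abs_mul_exp_of_mem_interior_integrableExpSet
    (mem_interior_muP hp s) hk

lemma integrable_mul_exp_muP {p : ℝ} (hp : 1 < p) (s : ℝ) :
    Integrable (fun y => y * Real.exp (s * y)) (muP p) := by
  refine (integrable_abs_rpow_exp_muP hp zero_le_one s).mono (by fun_prop) (ae_of_all _ fun y => ?_)
  simp

lemma integrable_abs_rpow_mul_exp_muP {p k : ℝ} (hp : 1 < p) (hk : -1 ≤ k) (s : ℝ) :
    Integrable (fun y => |y| ^ k * y * Real.exp (s * y)) (muP p) := by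
  refine (integrable_abs_rpow_exp_muP hp (k := k + 1) (by linarith) s).mono
    ((by fun_prop : Measurable _).aestronglyMeasurable) (ae_of_all _ fun y => ?_)
  rcases eq_or_ne y 0 with rfl | hy
  · simp
  · rw [Real.rpow_add_one (abs_ne_zero.2 hy)]
    simp

/-- Moment generating function of `μ_p`. -/
def mgfP (p s : ℝ) : ℝ := ∫ y, Real.exp (s * y) ∂(muP p)

/-- First exponential moment. -/
def mgfP₁ (p s : ℝ) : ℝ := ∫ y, y * Real.exp (s * y) ∂(muP p)

/-- `p`-th absolute exponential moment. -/
def mgfPabs (p s : ℝ) : ℝ := ∫ y, |y| ^ p * Real.exp (s * y) ∂(muP p)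

lemma mgfP_pos {p : ℝ} (hp : 1 < p) (s : ℝ) : 0 < mgfP p s := by
  have := isProbabilityMeasure_muP hp
  exact mgf_pos (X := id) (integrable_exp_muP hp s)

lemma mgfP_zero {p : ℝ} (hp : 1 < p) : mgfP p 0 = 1 := by
  have := isProbabilityMeasure_muP hp
  simp [mgfP]

lemma integral_muP_neg {p : ℝ} (hp : 1 < p) (f : ℝ → ℝ) :
    ∫ y, f (-y) ∂(muP p) = ∫ y, f y ∂(muP p) := by
  rw [integral_muP hp, integral_muP hp, ← integral_neg_eq_self]
  simp [densP_neg]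

lemma mgfP_neg {p : ℝ} (hp : 1 < p) (s : ℝ) : mgfP p (-s) = mgfP p s := by
  unfold mgfP
  rw [← integral_muP_neg hp]; simp

lemma mgfP₁_neg {p : ℝ} (hp : 1 < p) (s : ℝ) : mgfP₁ p (-s) = -mgfP₁ p s := by
  unfold mgfP₁
  rw [← integral_muP_neg hp, ← integral_neg]; simp

lemma mgfPabs_neg {p : ℝ} (hp : 1 < p) (s : ℝ) : mgfPabs p (-s) = mgfPabs p s := by
  unfold mgfPabs
  rw [← integral_muP_neg hp]; simp

lemma hasDerivAt_mgfP {p : ℝ} (hp : 1 < p) (s : ℝ) : HasDerivAt (mgfP p) (mgfP₁ p s) s :=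
  hasDerivAt_mgf (X := id) (mem_interior_muP hp s)

lemma continuous_mgfP {p : ℝ} (hp : 1 < p) : Continuous (mgfP p) :=
  continuous_iff_continuousAt.2 fun s => (hasDerivAt_mgfP hp s).continuousAt

lemma continuous_mgfP₁ {p : ℝ} (hp : 1 < p) : Continuous (mgfP₁ p) := by
  have h : mgfP₁ p = deriv (mgf id (muP p)) := by
    ext s; exact (hasDerivAt_mgfP hp s).deriv.symm
  rw [h, continuous_iff_continuousAt]
  intro s
  exact ((analyticOnNhd_mgf (X := id) (μ := muP p)).deriv s (mem_interior_muP hp s)).continuousAt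

lemma hasDerivAt_densP {p : ℝ} (hp : 1 < p) (y : ℝ) :
    HasDerivAt (densP p) (-(densP p y * (|y| ^ (p - 2) * y))) y := by
  have h := (((hasDerivAt_abs_rpow y hp).neg.div_const p).exp).const_mul (normZ p)⁻¹
  refine h.congr_deriv ?_
  have : p ≠ 0 := by linarith
  simp only [densP, Pi.neg_apply]
  field_simp

lemma abs_rpow_sub_two_mul_sq {p : ℝ} (hp : 1 < p) (y : ℝ) : |y| ^ (p - 2) * y * y = |y| ^ p := by
  rcases eq_or_ne y 0 with rfl | hy
  · simp [Real.zero_rpow (by linarith : p ≠ 0)]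
  · have : y * y = |y| ^ (2 : ℝ) := by simp [sq]
    rw [mul_assoc, this, ← Real.rpow_add (abs_pos.2 hy)]
    congr 1; ring

/-- Integration by parts against `y ↦ y`. -/
lemma mgfPabs_eq {p : ℝ} (hp : 1 < p) (s : ℝ) :
    mgfPabs p s = mgfP p s + s * mgfP₁ p s := by
  have i1 := (integrable_muP_iff hp).1 (integrable_exp_muP hp s)
  have i2 := (integrable_muP_iff hp).1 (integrable_mul_exp_muP hp s)
  have i3 := (integrable_muP_iff hp).1 (integrable_abs_rpow_exp_muP hp (by linarith : 0 ≤ p) s)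
  have key := integral_eq_zero_of_hasDerivAt_of_integrable
    (f := fun y => densP p y * (y * Real.exp (s * y)))
    (f' := fun y => densP p y * Real.exp (s * y) + s * (densP p y * (y * Real.exp (s * y)))
        - densP p y * (|y| ^ p * Real.exp (s * y)))
    (fun y => ?_) ((i1.add (i2.const_mul s)).sub i3) i2
  · rw [integral_sub (by exact i1.add (i2.const_mul s)) i3, integral_add i1 (i2.const_mul s),
      integral_const_mul] at key
    simp only [mgfPabs, mgfP, mgfP₁, integral_muP hp]
    linarith
  · have h1 : HasDerivAt (fun y : ℝ => Real.exp (s * y)) (Real.exp (s * y) * s) y := by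
      simpa using ((hasDerivAt_id y).const_mul s).exp
    refine ((hasDerivAt_densP hp y).mul ((hasDerivAt_id y).mul h1)).congr_deriv ?_
    rw [← abs_rpow_sub_two_mul_sq hp y]
    simp only [id, Pi.mul_apply]
    ring

/-- Integration by parts against constants. -/
lemma integral_abs_rpow_mul_exp_muP {p : ℝ} (hp : 1 < p) (s : ℝ) :
    ∫ y, |y| ^ (p - 2) * y * Real.exp (s * y) ∂(muP p) = s * mgfP p s := by
  have i1 := (integrable_muP_iff hp).1 (integrable_exp_muP hp s)
  have i3 := (integrable_muP_iff hp).1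
    (integrable_abs_rpow_mul_exp_muP hp (by linarith : -1 ≤ p - 2) s)
  have key := integral_eq_zero_of_hasDerivAt_of_integrable
    (f := fun y => densP p y * Real.exp (s * y))
    (f' := fun y => s * (densP p y * Real.exp (s * y))
        - densP p y * (|y| ^ (p - 2) * y * Real.exp (s * y)))
    (fun y => ?_) ((i1.const_mul s).sub i3) i1
  · rw [integral_sub (i1.const_mul s) i3, integral_const_mul] at key
    simp only [mgfP, integral_muP hp]
    linarith
  · have h1 : HasDerivAt (fun y : ℝ => Real.exp (s * y)) (Real.exp (s * y) * s) y := by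
      simpa using ((hasDerivAt_id y).const_mul s).exp
    refine ((hasDerivAt_densP hp y).mul h1).congr_deriv ?_
    ring

lemma mgfPabs_pos {p : ℝ} (hp : 1 < p) (s : ℝ) : 0 < mgfPabs p s := by
  have i3 := (integrable_muP_iff hp).1 (integrable_abs_rpow_exp_muP hp (by linarith : 0 ≤ p) s)
  rw [mgfPabs, integral_muP hp]
  refine (integral_pos_iff_support_of_nonneg (fun y => ?_) i3).2 ?_
  · have := densP_pos hp y
    simp only [Pi.zero_apply]; positivity
  · refine lt_of_lt_of_le (b := volume (Ioo (0 : ℝ) 1)) (by simp) (measure_mono fun y hy => ?_)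
    have := densP_pos hp y
    have : 0 < |y| := abs_pos.2 hy.1.ne'
    simp only [Function.mem_support]
    positivity

lemma mgfP_mul_le {p : ℝ} (hp : 1 < p) (s : ℝ) :
    s ≤ (mgfPabs p s / mgfP p s) ^ ((p - 1) / p) := by
  have hA : 0 < mgfPabs p s / mgfP p s := div_pos (mgfPabs_pos hp s) (mgfP_pos hp s)
  set A := mgfPabs p s / mgfP p s with hAdef
  have hM := mgfP_pos hp s
  have hp0 : 0 < p := by linarith
  have i1 := integrable_exp_muP hp s
  have i2 := integrable_abs_rpow_exp_muP hp hp0.le s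
  have i3 := integrable_abs_rpow_mul_exp_muP hp (by linarith : -1 ≤ p - 2) s
  set θ := (p - 1) / p with hθ
  have hθ0 : 0 ≤ θ := div_nonneg (by linarith) hp0.le
  have hθ1 : θ + 1 / p = 1 := by rw [hθ]; field_simp; ring
  have hpt : ∀ y : ℝ, |y| ^ (p - 2) * y * Real.exp (s * y) ≤
      A ^ θ * (θ / A * (|y| ^ p * Real.exp (s * y)) + 1 / p * Real.exp (s * y)) := by
    intro y
    have h1 : |y| ^ (p - 2) * y ≤ |y| ^ (p - 1) := by
      rcases eq_or_ne y 0 with rfl | hy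
      · simp; positivity
      · have : |y| ^ (p - 1) = |y| ^ (p - 2) * |y| := by
          rw [← Real.rpow_add_one (abs_ne_zero.2 hy)]; congr 1; ring
        rw [this]
        gcongr
        exact le_abs_self y
    have h2 : |y| ^ (p - 1) = A ^ θ * (|y| ^ p / A) ^ θ := by
      rw [← Real.mul_rpow hA.le (by positivity), mul_div_cancel₀ _ hA.ne',
        ← Real.rpow_mul (abs_nonneg y)]
      congr 1; rw [hθ]; field_simp
    have h3 := Real.geom_mean_le_arith_mean2_weighted hθ0 (by positivity : 0 ≤ 1 / p)
      (by positivity : 0 ≤ |y| ^ p / A) zero_le_one hθ1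
    rw [Real.one_rpow, mul_one, mul_one] at h3
    calc |y| ^ (p - 2) * y * Real.exp (s * y)
        ≤ (A ^ θ * (θ * (|y| ^ p / A) + 1 / p)) * Real.exp (s * y) := by
          refine mul_le_mul_of_nonneg_right ?_ (Real.exp_pos _).le
          exact h1.trans (h2.le.trans (by gcongr))
      _ = _ := by ring
  have h := integral_mono i3 (((i2.const_mul (θ / A)).add (i1.const_mul (1 / p))).const_mul (A ^ θ))
    hpt
  simp only [Pi.add_apply] at h
  rw [integral_abs_rpow_mul_exp_muP hp, integral_const_mul, integral_add (i2.const_mul _)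
    (i1.const_mul _), integral_const_mul, integral_const_mul] at h
  change s * mgfP p s ≤ A ^ θ * (θ / A * mgfPabs p s + 1 / p * mgfP p s) at h
  have h4 : mgfPabs p s = A * mgfP p s := by rw [hAdef]; field_simp
  rw [h4] at h
  have h5 : A ^ θ * (θ / A * (A * mgfP p s) + 1 / p * mgfP p s) = A ^ θ * mgfP p s := by
    rw [← mul_assoc (θ / A), div_mul_cancel₀ _ hA.ne', ← add_mul, hθ1, one_mul]
  rw [h5] at h
  exact le_of_mul_le_mul_right h hM

/-- Every `w ∈ [0, 1)` is the normalised mean of some exponential tilt of `μ_p`. -/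
lemma exists_tilt_nonneg {p w : ℝ} (hp : 1 < p) (hw0 : 0 ≤ w) (hw1 : w < 1) :
    ∃ s : ℝ, ∃ r > 0, mgfPabs p s / mgfP p s = r ^ p ∧ mgfP₁ p s / mgfP p s = r * w := by
  have hp0 : 0 < p := by linarith
  set A : ℝ → ℝ := fun s => mgfPabs p s / mgfP p s with hA
  have hApos : ∀ s, 0 < A s := fun s => div_pos (mgfPabs_pos hp s) (mgfP_pos hp s)
  have hAeq : ∀ s, A s = 1 + s * (mgfP₁ p s / mgfP p s) := fun s => by
    have := (mgfP_pos hp s).ne'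
    simp only [hA]; rw [mgfPabs_eq hp]; field_simp
  have hmc : Continuous fun s => mgfP₁ p s / mgfP p s :=
    (continuous_mgfP₁ hp).div (continuous_mgfP hp) fun s => (mgfP_pos hp s).ne'
  have hAc : Continuous A := by
    have : A = fun s => 1 + s * (mgfP₁ p s / mgfP p s) := funext hAeq
    rw [this]; fun_prop
  set R : ℝ → ℝ := fun s => mgfP₁ p s / mgfP p s / A s ^ (1 / p) with hR
  have hRc : Continuous R := hmc.div (hAc.rpow_const fun s => Or.inl (hApos s).ne')
    fun s => (Real.rpow_pos_of_pos (hApos s) _).ne'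
  have h0 : R 0 = 0 := by
    have := mgfP₁_neg hp 0
    rw [neg_zero] at this
    have : mgfP₁ p 0 = 0 := by linarith
    simp [hR, this]
  set S := 1 / (1 - w) with hS
  have hw' : 0 < 1 - w := by linarith
  have hS1 : 1 ≤ S := by rw [hS, le_div_iff₀ hw']; linarith
  have hSw : w ≤ R S := by
    have h1 := mgfP_mul_le hp S
    change S ≤ A S ^ ((p - 1) / p) at h1
    have hA1 : 1 ≤ A S := by
      by_contra hlt
      push Not at hlt
      have := Real.rpow_lt_one (hApos S).le hlt (z := (p - 1) / p) (div_pos (by linarith) hp0)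
      linarith
    have hc1 : 1 ≤ A S ^ (1 / p) := Real.one_le_rpow hA1 (by positivity)
    have hsplit : A S = A S ^ ((p - 1) / p) * A S ^ (1 / p) := by
      rw [← Real.rpow_add (hApos S)]
      have : (p - 1) / p + 1 / p = 1 := by field_simp; ring
      rw [this, Real.rpow_one]
    have hm : mgfP₁ p S / mgfP p S = (A S - 1) / S := by
      rw [hAeq S]; field_simp; ring
    have hwS : w = (S - 1) / S := by rw [hS]; field_simp; ring
    have hS0 : 0 < S := by linarith
    have hc0 : 0 < A S ^ (1 / p) := by linarith
    simp only [hR]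
    rw [hm, le_div_iff₀ hc0, hwS, div_mul_eq_mul_div, div_le_div_iff_of_pos_right hS0]
    nlinarith
  obtain ⟨s, -, hs⟩ := intermediate_value_Icc (by linarith : (0 : ℝ) ≤ S) hRc.continuousOn
    (show w ∈ Icc (R 0) (R S) from ⟨by rw [h0]; exact hw0, hSw⟩)
  refine ⟨s, A s ^ (1 / p), Real.rpow_pos_of_pos (hApos s) _, ?_, ?_⟩
  · rw [← Real.rpow_mul (hApos s).le, one_div_mul_cancel hp0.ne', Real.rpow_one]
  · have := (Real.rpow_pos_of_pos (hApos s) (1 / p)).ne'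
    rw [← hs]; simp only [hR]; field_simp

/-- Every `w ∈ (-1, 1)` is the normalised mean of some exponential tilt of `μ_p`. -/
lemma exists_tilt {p w : ℝ} (hp : 1 < p) (hw : w ∈ Ioo (-1 : ℝ) 1) :
    ∃ s : ℝ, ∃ r > 0, mgfPabs p s / mgfP p s = r ^ p ∧ mgfP₁ p s / mgfP p s = r * w := by
  rcases le_total 0 w with h | h
  · exact exists_tilt_nonneg hp h hw.2
  · obtain ⟨s, r, hr, h1, h2⟩ := exists_tilt_nonneg hp (neg_nonneg.2 h) (by linarith [hw.1])
    refine ⟨-s, r, hr, by rwa [mgfPabs_neg hp, mgfP_neg hp], ?_⟩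
    rw [mgfP₁_neg hp, mgfP_neg hp, neg_div, h2]; ring

lemma strictMonoOn_sinh_div_sinh {s t : ℝ} (hs : 0 < s) (hst : s < t) :
    StrictMonoOn (fun y => Real.sinh (t * y) / Real.sinh (s * y)) (Ioi 0) := by
  have dS : ∀ c y : ℝ, HasDerivAt (fun y => Real.sinh (c * y)) (Real.cosh (c * y) * c) y :=
    fun c y => by simpa using ((hasDerivAt_id y).const_mul c).sinh
  have dC : ∀ c y : ℝ, HasDerivAt (fun y => Real.cosh (c * y)) (Real.sinh (c * y) * c) y :=
    fun c y => by simpa using ((hasDerivAt_id y).const_mul c).cosh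
  set U : ℝ → ℝ := fun y => Real.cosh (t * y) * t * Real.sinh (s * y)
    - Real.sinh (t * y) * (Real.cosh (s * y) * s) with hU
  have dU : ∀ y, HasDerivAt U ((t ^ 2 - s ^ 2) * (Real.sinh (t * y) * Real.sinh (s * y))) y := by
    intro y
    refine ((((dC t y).mul_const t).mul (dS s y)).sub
      ((dS t y).mul ((dC s y).mul_const s))).congr_deriv ?_
    ring
  have ht : 0 < t := hs.trans hst
  have hUmono : StrictMonoOn U (Ici 0) := by
    refine strictMonoOn_of_deriv_pos (convex_Ici 0)
      (fun y _ => (dU y).continuousAt.continuousWithinAt) fun y hy => ?_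
    rw [interior_Ici] at hy
    rw [(dU y).deriv]
    have h1 : 0 < Real.sinh (t * y) := Real.sinh_pos_iff.2 (mul_pos ht hy)
    have h2 : 0 < Real.sinh (s * y) := Real.sinh_pos_iff.2 (mul_pos hs hy)
    have h3 : 0 < t ^ 2 - s ^ 2 := by nlinarith
    positivity
  have hUpos : ∀ y, 0 < y → 0 < U y := fun y hy => by
    have := hUmono (mem_Ici.2 (le_refl (0 : ℝ))) hy.le hy
    simpa [hU] using this
  have hsinh : ∀ y, 0 < y → Real.sinh (s * y) ≠ 0 := fun y hy =>
    (Real.sinh_pos_iff.2 (mul_pos hs hy)).ne'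
  refine strictMonoOn_of_deriv_pos (convex_Ioi 0)
      (fun y hy => ((dS t y).div (dS s y) (hsinh y hy)).continuousAt.continuousWithinAt)
      fun y hy => ?_
  rw [interior_Ioi] at hy
  have hd : HasDerivAt (fun y => Real.sinh (t * y) / Real.sinh (s * y))
      (U y / Real.sinh (s * y) ^ 2) y := (dS t y).div (dS s y) (hsinh y hy)
  rw [hd.deriv]
  exact div_pos (hUpos y hy) (pow_pos (Real.sinh_pos_iff.2 (mul_pos hs hy)) 2)

lemma integral_muP_pos {p a : ℝ} (hp : 1 < p) {f : ℝ → ℝ} (hf : Integrable f (muP p))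
    (h0 : ∀ y, 0 ≤ f y) (hpos : ∀ y, a < y → 0 < f y) : 0 < ∫ y, f y ∂(muP p) := by
  rw [integral_muP hp]
  refine (integral_pos_iff_support_of_nonneg (fun y => ?_) ((integrable_muP_iff hp).1 hf)).2 ?_
  · exact mul_nonneg (densP_pos hp y).le (h0 y)
  · refine lt_of_lt_of_le (b := volume (Ioo a (a + 1))) (by simp) (measure_mono fun y hy => ?_)
    exact (mul_pos (densP_pos hp y) (hpos y hy.1)).ne'

lemma integrable_sinh_muP {p k : ℝ} (hp : 1 < p) (hk : -1 ≤ k) (s : ℝ) :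
    Integrable (fun y => |y| ^ k * (y * Real.sinh (s * y))) (muP p) := by
  have h := ((integrable_abs_rpow_mul_exp_muP hp hk s).sub
    (integrable_abs_rpow_mul_exp_muP hp hk (-s))).div_const 2
  refine h.congr (ae_of_all _ fun y => ?_)
  simp only [Pi.sub_apply, Real.sinh_eq]
  rw [neg_mul]; ring

lemma integral_sinh_muP {p k : ℝ} (hp : 1 < p) (hk : -1 ≤ k) (s : ℝ) :
    ∫ y, |y| ^ k * (y * Real.sinh (s * y)) ∂(muP p)
      = ∫ y, |y| ^ k * y * Real.exp (s * y) ∂(muP p) := by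
  have i1 := integrable_abs_rpow_mul_exp_muP hp hk s
  have i2 := integrable_abs_rpow_mul_exp_muP hp hk (-s)
  have h1 : ∫ y, |y| ^ k * y * Real.exp (-s * y) ∂(muP p)
      = -∫ y, |y| ^ k * y * Real.exp (s * y) ∂(muP p) := by
    rw [← integral_muP_neg hp, ← integral_neg]; simp
  have h2 : ∀ y, |y| ^ k * (y * Real.sinh (s * y))
      = (|y| ^ k * y * Real.exp (s * y) - |y| ^ k * y * Real.exp (-s * y)) / 2 := by
    intro y; rw [Real.sinh_eq, neg_mul]; ring
  simp_rw [h2]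
  rw [integral_div, integral_sub i1 i2, h1]; ring

lemma integral_mul_sinh_muP {p : ℝ} (hp : 1 < p) (s : ℝ) :
    ∫ y, y * Real.sinh (s * y) ∂(muP p) = mgfP₁ p s := by
  simpa [mgfP₁] using integral_sinh_muP hp (k := 0) (by norm_num) s

lemma integrable_mul_sinh_muP {p : ℝ} (hp : 1 < p) (s : ℝ) :
    Integrable (fun y => y * Real.sinh (s * y)) (muP p) := by
  simpa using integrable_sinh_muP hp (k := 0) (by norm_num) s

lemma integral_abs_rpow_sinh_muP {p : ℝ} (hp : 1 < p) (s : ℝ) :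
    ∫ y, |y| ^ (p - 2) * (y * Real.sinh (s * y)) ∂(muP p) = s * mgfP p s := by
  rw [integral_sinh_muP hp (by linarith), integral_abs_rpow_mul_exp_muP hp]

lemma mul_sinh_nonneg {s : ℝ} (hs : 0 < s) (y : ℝ) : 0 ≤ y * Real.sinh (s * y) := by
  rcases le_total 0 y with h | h
  · exact mul_nonneg h (Real.sinh_nonneg_iff.2 (by positivity))
  · exact mul_nonneg_of_nonpos_of_nonpos h
      (Real.sinh_nonpos_iff.2 (mul_nonpos_of_nonneg_of_nonpos hs.le h))

lemma mgfP₁_pos {p s : ℝ} (hp : 1 < p) (hs : 0 < s) : 0 < mgfP₁ p s := by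
  rw [← integral_mul_sinh_muP hp]
  exact integral_muP_pos (a := 0) hp (integrable_mul_sinh_muP hp s) (mul_sinh_nonneg hs)
    fun y hy => mul_pos hy (Real.sinh_pos_iff.2 (mul_pos hs hy))

/-- Correlation inequality behind the monotonicity of `s ↦ (log mgfP)'(s) / s`. -/
lemma mgfP₁_div_compare {p s t σ : ℝ} (hp : 1 < p) (hs : 0 < s) (hst : s < t)
    (hσ : ∀ a b : ℝ, 0 < a → a < b → σ * a ^ (p - 2) < σ * b ^ (p - 2)) :
    σ * (s * mgfP p s * mgfP₁ p t) < σ * (t * mgfP p t * mgfP₁ p s) := by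
  have ht : 0 < t := hs.trans hst
  have hms := mgfP₁_pos hp hs
  set ρ := mgfP₁ p t / mgfP₁ p s with hρ
  set D : ℝ → ℝ := fun y => Real.sinh (t * y) - ρ * Real.sinh (s * y) with hD
  have hDc : Continuous D := by
    simp only [hD]
    exact (Real.continuous_sinh.comp (by fun_prop)).sub
      (continuous_const.mul (Real.continuous_sinh.comp (by fun_prop)))
  have hDneg : ∀ y, D (-y) = -D y := fun y => by simp [hD]; ring
  have hQi : Integrable (fun y => y * D y) (muP p) := by
    refine ((integrable_mul_sinh_muP hp t).sub
      ((integrable_mul_sinh_muP hp s).const_mul ρ)).congr (ae_of_all _ fun y => ?_)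
    simp only [hD, Pi.sub_apply]; ring
  have hQ0 : ∫ y, y * D y ∂(muP p) = 0 := by
    have : ∀ y, y * D y = y * Real.sinh (t * y) - ρ * (y * Real.sinh (s * y)) := fun y => by
      simp only [hD]; ring
    simp_rw [this]
    rw [integral_sub (integrable_mul_sinh_muP hp t) ((integrable_mul_sinh_muP hp s).const_mul ρ),
      integral_const_mul, integral_mul_sinh_muP hp, integral_mul_sinh_muP hp, hρ]
    field_simp; ring
  have hsign : ∀ τ : ℝ, (∀ y, 0 < y → 0 < τ * D y) → False := by
    intro τ hτ
    have : 0 < ∫ y, τ * (y * D y) ∂(muP p) := by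
      refine integral_muP_pos (a := 0) hp (hQi.const_mul τ) (fun y => ?_) fun y hy => ?_
      · rcases lt_trichotomy y 0 with h | h | h
        · have := hτ (-y) (by linarith)
          rw [hDneg] at this
          nlinarith
        · simp [h]
        · nlinarith [hτ y h]
      · nlinarith [hτ y hy, mul_pos hy (hτ y hy)]
    rw [integral_const_mul, hQ0, mul_zero] at this
    exact lt_irrefl _ this
  obtain ⟨y₀, hy₀, hD0⟩ : ∃ y₀, 0 < y₀ ∧ D y₀ = 0 := by
    by_contra hne
    push Not at hne
    have hpre : IsPreconnected (Ioi (0 : ℝ)) := isPreconnected_Ioi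
    by_cases hpos : ∃ a, 0 < a ∧ 0 < D a
    · by_cases hneg : ∃ b, 0 < b ∧ D b < 0
      · obtain ⟨a, ha, hDa⟩ := hpos
        obtain ⟨b, hb, hDb⟩ := hneg
        obtain ⟨c, hc, hDc0⟩ := hpre.intermediate_value hb ha hDc.continuousOn
          (show (0 : ℝ) ∈ Icc (D b) (D a) from ⟨hDb.le, hDa.le⟩)
        exact hne c hc hDc0
      · push Not at hneg
        exact hsign 1 fun y hy => by
          rw [one_mul]; exact lt_of_le_of_ne (hneg y hy) (hne y hy).symm
    · push Not at hpos
      exact hsign (-1) fun y hy => by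
        have := lt_of_le_of_ne (hpos y hy) (hne y hy)
        linarith
  have hsy₀ : 0 < Real.sinh (s * y₀) := Real.sinh_pos_iff.2 (mul_pos hs hy₀)
  have hρ' : ρ = Real.sinh (t * y₀) / Real.sinh (s * y₀) := by
    rw [eq_div_iff hsy₀.ne']; simp only [hD] at hD0; linarith
  have hDpos : ∀ y, y₀ < y → 0 < D y := fun y hy => by
    have hyp : 0 < y := hy₀.trans hy
    have h1 := strictMonoOn_sinh_div_sinh hs hst hy₀ hyp hy
    simp only at h1
    rw [← hρ', lt_div_iff₀ (Real.sinh_pos_iff.2 (mul_pos hs hyp))] at h1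
    simp only [hD]; linarith
  have hDlt : ∀ y, 0 < y → y < y₀ → D y < 0 := fun y hyp hy => by
    have h1 := strictMonoOn_sinh_div_sinh hs hst hyp hy₀ hy
    simp only at h1
    rw [← hρ', div_lt_iff₀ (Real.sinh_pos_iff.2 (mul_pos hs hyp))] at h1
    simp only [hD]; linarith
  have it := integrable_sinh_muP hp (by linarith : -1 ≤ p - 2) t
  have is := integrable_sinh_muP hp (by linarith : -1 ≤ p - 2) s
  have hKi : Integrable (fun y => |y| ^ (p - 2) * (y * D y)) (muP p) := by
    refine (it.sub (is.const_mul ρ)).congr (ae_of_all _ fun y => ?_)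
    simp only [hD, Pi.sub_apply]; ring
  have hKint : ∫ y, |y| ^ (p - 2) * (y * D y) ∂(muP p) = t * mgfP p t - ρ * (s * mgfP p s) := by
    have : ∀ y, |y| ^ (p - 2) * (y * D y) = |y| ^ (p - 2) * (y * Real.sinh (t * y))
        - ρ * (|y| ^ (p - 2) * (y * Real.sinh (s * y))) := fun y => by simp only [hD]; ring
    simp_rw [this]
    rw [integral_sub it (is.const_mul ρ), integral_const_mul, integral_abs_rpow_sinh_muP hp,
      integral_abs_rpow_sinh_muP hp]
  have hpos_case : ∀ y, 0 < y → y ≠ y₀ → 0 < (σ * y ^ (p - 2) - σ * y₀ ^ (p - 2)) * (y * D y) := by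
    intro y hy hne
    rcases lt_or_gt_of_ne hne with h | h
    · have h1 := hσ y y₀ hy h
      have h2 := hDlt y hy h
      exact mul_pos_of_neg_of_neg (by linarith) (mul_neg_of_pos_of_neg hy h2)
    · have h1 := hσ y₀ y hy₀ h
      exact mul_pos (by linarith) (mul_pos hy (hDpos y h))
  have hcase : ∀ y, 0 < y → 0 ≤ (σ * y ^ (p - 2) - σ * y₀ ^ (p - 2)) * (y * D y) := by
    intro y hy
    rcases eq_or_ne y y₀ with rfl | h
    · simp
    · exact (hpos_case y hy h).le
  have hfin : 0 < ∫ y, (σ * |y| ^ (p - 2) - σ * y₀ ^ (p - 2)) * (y * D y) ∂(muP p) := by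
    refine integral_muP_pos (a := y₀) hp ?_ (fun y => ?_) fun y hy => ?_
    · refine ((hKi.const_mul σ).sub (hQi.const_mul (σ * y₀ ^ (p - 2)))).congr
        (ae_of_all _ fun y => ?_)
      simp only [Pi.sub_apply]; ring
    · rcases lt_trichotomy y 0 with h | h | h
      · have := hcase (-y) (by linarith)
        rw [hDneg] at this
        rw [abs_of_neg h]; simpa using this
      · simp [h]
      · rw [abs_of_pos h]; exact hcase y h
    · rw [abs_of_pos (hy₀.trans hy)]; exact hpos_case y (hy₀.trans hy) hy.ne'
  have hsplit : ∀ y, (σ * |y| ^ (p - 2) - σ * y₀ ^ (p - 2)) * (y * D y)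
      = σ * (|y| ^ (p - 2) * (y * D y)) - σ * y₀ ^ (p - 2) * (y * D y) := fun y => by ring
  simp_rw [hsplit] at hfin
  rw [integral_sub (hKi.const_mul σ) (hQi.const_mul _), integral_const_mul, integral_const_mul,
    hQ0, hKint, mul_zero, sub_zero] at hfin
  have : σ * (t * mgfP p t * mgfP₁ p s) - σ * (s * mgfP p s * mgfP₁ p t)
      = σ * (t * mgfP p t - ρ * (s * mgfP p s)) * mgfP₁ p s := by
    rw [hρ]; field_simp
  nlinarith [mul_pos hfin hms]

/-- Cumulant generating function of `μ_p`. -/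
def cgfP (p s : ℝ) : ℝ := Real.log (mgfP p s)

lemma continuous_cgfP {p : ℝ} (hp : 1 < p) : Continuous (cgfP p) :=
  (continuous_mgfP hp).log fun s => (mgfP_pos hp s).ne'

lemma cgfP_zero {p : ℝ} (hp : 1 < p) : cgfP p 0 = 0 := by simp [cgfP, mgfP_zero hp]

lemma cgfP_neg {p : ℝ} (hp : 1 < p) (s : ℝ) : cgfP p (-s) = cgfP p s := by
  rw [cgfP, mgfP_neg hp, cgfP]

lemma cgfP_abs {p : ℝ} (hp : 1 < p) (s : ℝ) : cgfP p |s| = cgfP p s := by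
  rcases abs_choice s with h | h <;> rw [h]
  exact cgfP_neg hp s

lemma mgfP₁_zero {p : ℝ} (hp : 1 < p) : mgfP₁ p 0 = 0 := by
  have := mgfP₁_neg hp 0
  rw [neg_zero] at this
  linarith

lemma one_le_mgfP {p : ℝ} (hp : 1 < p) (s : ℝ) : 1 ≤ mgfP p s := by
  have := isProbabilityMeasure_muP hp
  have i0 : Integrable (fun y : ℝ => y) (muP p) := by simpa using integrable_mul_exp_muP hp 0
  have h0 : ∫ y, y ∂(muP p) = 0 := by simpa [mgfP₁] using mgfP₁_zero hp
  have := integral_mono ((i0.const_mul s).add (integrable_const 1)) (integrable_exp_muP hp s)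
    fun y => Real.add_one_le_exp (s * y)
  simp only [Pi.add_apply] at this
  rw [integral_add (i0.const_mul s) (integrable_const 1), integral_const_mul, h0] at this
  simpa [mgfP] using this

lemma cgfP_nonneg {p : ℝ} (hp : 1 < p) (s : ℝ) : 0 ≤ cgfP p s :=
  Real.log_nonneg (one_le_mgfP hp s)

lemma hasDerivAt_cgfP_sqrt {p x : ℝ} (hp : 1 < p) (hx : 0 < x) :
    HasDerivAt (fun x => cgfP p √x) (mgfP₁ p √x / mgfP p √x / (2 * √x)) x := by
  have h1 : HasDerivAt (cgfP p) (mgfP₁ p √x / mgfP p √x) √x :=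
    (hasDerivAt_mgfP hp _).log (mgfP_pos hp _).ne'
  refine (h1.comp x (Real.hasDerivAt_sqrt hx.ne')).congr_deriv ?_
  ring

lemma deriv_cgfP_sqrt_compare {p x y σ : ℝ} (hp : 1 < p) (hx : 0 < x) (hxy : x < y)
    (hσ : ∀ a b : ℝ, 0 < a → a < b → σ * a ^ (p - 2) < σ * b ^ (p - 2)) :
    σ * deriv (fun x => cgfP p √x) y < σ * deriv (fun x => cgfP p √x) x := by
  have hy : 0 < y := hx.trans hxy
  rw [(hasDerivAt_cgfP_sqrt hp hx).deriv, (hasDerivAt_cgfP_sqrt hp hy).deriv]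
  have hsx := Real.sqrt_pos.2 hx
  have hsy := Real.sqrt_pos.2 hy
  have h := mgfP₁_div_compare hp hsx (Real.sqrt_lt_sqrt hx.le hxy) hσ
  have hMx := mgfP_pos hp √x
  have hMy := mgfP_pos hp √y
  rw [div_div, div_div, ← mul_div_assoc, ← mul_div_assoc, div_lt_div_iff₀ (by positivity)
    (by positivity)]
  nlinarith

lemma continuousOn_cgfP_sqrt {p : ℝ} (hp : 1 < p) :
    ContinuousOn (fun x => cgfP p √x) (Ici 0) :=
  ((continuous_cgfP hp).comp Real.continuous_sqrt).continuousOn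

lemma strictConvexOn_cgfP_sqrt {p : ℝ} (hp : 1 < p) (hp2 : p < 2) :
    StrictConvexOn ℝ (Ici 0) (fun x => cgfP p √x) := by
  refine StrictMonoOn.strictConvexOn_of_deriv (convex_Ici 0) (continuousOn_cgfP_sqrt hp) ?_
  rw [interior_Ici]
  intro x hx y _ hxy
  have := deriv_cgfP_sqrt_compare (σ := -1) hp hx hxy fun a b ha hab => by
    have := Real.rpow_lt_rpow_of_neg ha hab (by linarith : p - 2 < 0)
    linarith
  linarith

lemma strictConcaveOn_cgfP_sqrt {p : ℝ} (hp2 : 2 < p) :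
    StrictConcaveOn ℝ (Ici 0) (fun x => cgfP p √x) := by
  have hp : 1 < p := by linarith
  refine StrictAntiOn.strictConcaveOn_of_deriv (convex_Ici 0) (continuousOn_cgfP_sqrt hp) ?_
  rw [interior_Ici]
  intro x hx y _ hxy
  have := deriv_cgfP_sqrt_compare (σ := 1) hp hx hxy fun a b ha hab => by
    have := Real.rpow_lt_rpow ha.le hab (by linarith : 0 < p - 2)
    linarith
  linarith

lemma muP_two : muP 2 = gaussianReal 0 1 := by
  rw [gaussianReal_of_var_ne_zero _ one_ne_zero, muP_eq]
  congr 1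
  ext y
  rw [gaussianPDF, densP, gaussianPDFReal]
  have hG : Real.Gamma (1 + 1 / 2) = √Real.pi / 2 := by
    rw [add_comm, Real.Gamma_add_one (by norm_num), Real.Gamma_one_half_eq]; ring
  have hZ : normZ 2 = √(2 * Real.pi * ((1 : ℝ≥0) : ℝ)) := by
    rw [normZ, hG, ← Real.sqrt_eq_rpow, NNReal.coe_one, mul_one, Real.sqrt_mul (by norm_num)]
    ring
  rw [hZ]
  simp

/-- Growth bound for `cgfP`. -/
lemma exists_cgfP_le {p : ℝ} (hp : 1 < p) :
    ∃ C K k : ℝ, 0 ≤ C ∧ 0 ≤ k ∧ ∀ s, cgfP p s ≤ C * |s| ^ k + K := by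
  have hp0 : 0 < p := by linarith
  have hp1 : 0 < p - 1 := by linarith
  have hi : Integrable (fun y => Real.exp (1 / (2 * p) * |y| ^ p)) (muP p) := by
    rw [integrable_muP_iff hp]
    refine ((integrable_exp_neg_mul_abs_rpow hp (b := 1 / (2 * p)) (by positivity)).const_mul
      (normZ p)⁻¹).congr (ae_of_all _ fun y => ?_)
    simp only [densP]
    rw [mul_assoc, ← Real.exp_add]
    congr 2; field_simp; ring
  refine ⟨(2 * p) ^ (1 / (p - 1)), Real.log (∫ y, Real.exp (1 / (2 * p) * |y| ^ p) ∂(muP p)),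
    1 + 1 / (p - 1), by positivity, by positivity, fun s => ?_⟩
  set B := |s| * (|s| / (1 / (2 * p))) ^ (1 / (p - 1)) with hB
  have hB' : B = (2 * p) ^ (1 / (p - 1)) * |s| ^ (1 + 1 / (p - 1)) := by
    rw [hB, div_div_eq_mul_div, div_one, Real.mul_rpow (abs_nonneg s) (by positivity),
      Real.rpow_add_of_nonneg (abs_nonneg s) zero_le_one (by positivity), Real.rpow_one]
    ring
  have h1 : mgfP p s ≤ Real.exp B * ∫ y, Real.exp (1 / (2 * p) * |y| ^ p) ∂(muP p) := by
    rw [← integral_const_mul]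
    refine integral_mono (integrable_exp_muP hp s) (hi.const_mul _) fun y => ?_
    simp only
    rw [← Real.exp_add]
    have := mul_le_mul_abs_rpow_add hp (b := 1 / (2 * p)) (by positivity) s y
    gcongr; linarith
  have hIpos : 0 < ∫ y, Real.exp (1 / (2 * p) * |y| ^ p) ∂(muP p) :=
    pos_of_mul_pos_right ((mgfP_pos hp s).trans_le h1) (Real.exp_pos _).le
  rw [cgfP, ← hB']
  refine (Real.log_le_log (mgfP_pos hp s) h1).trans_eq ?_
  rw [Real.log_mul (Real.exp_pos _).ne' hIpos.ne', Real.log_exp]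

lemma integrable_abs_rpow_gaussian {k : ℝ} (hk : 0 ≤ k) :
    Integrable (fun u : ℝ => |u| ^ k) (gaussianReal 0 1) := by
  have h := (memLp_id_gaussianReal (μ := 0) (v := 1) k.toNNReal).integrable_norm_rpow'
  simpa [Real.coe_toNNReal k hk] using h

lemma integrable_cgfP_gaussian {p : ℝ} (hp : 1 < p) (s : ℝ) :
    Integrable (fun u => cgfP p (s * u)) (gaussianReal 0 1) := by
  obtain ⟨C, K, k, hC, hk, h⟩ := exists_cgfP_le hp
  refine Integrable.mono' (g := fun u => C * |s| ^ k * |u| ^ k + K)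
    (((integrable_abs_rpow_gaussian hk).const_mul _).add (integrable_const K))
    ((continuous_cgfP hp).comp (by fun_prop)).aestronglyMeasurable (ae_of_all _ fun u => ?_)
  rw [Real.norm_of_nonneg (cgfP_nonneg hp _)]
  refine (h _).trans_eq ?_
  rw [abs_mul, Real.mul_rpow (abs_nonneg s) (abs_nonneg u)]; ring

/-- Gaussian average of the cumulant generating function of `μ_p`. -/
def gaussCgfP (p s : ℝ) : ℝ := ∫ u, cgfP p (s * u) ∂(gaussianReal 0 1)

lemma gaussCgfP_nonneg {p : ℝ} (hp : 1 < p) (s : ℝ) : 0 ≤ gaussCgfP p s :=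
  integral_nonneg fun _ => cgfP_nonneg hp _

lemma gaussCgfP_zero {p : ℝ} (hp : 1 < p) : gaussCgfP p 0 = 0 := by
  simp [gaussCgfP, cgfP_zero hp]

lemma continuousOn_gaussCgfP {p : ℝ} (hp : 1 < p) (S : ℝ) :
    ContinuousOn (gaussCgfP p) (Icc 0 S) := by
  obtain ⟨C, K, k, hC, hk, h⟩ := exists_cgfP_le hp
  refine continuousOn_of_dominated (bound := fun u => C * S ^ k * |u| ^ k + K)
    (fun s _ => ((continuous_cgfP hp).comp (by fun_prop)).aestronglyMeasurable)
    (fun s hs => ae_of_all _ fun u => ?_)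
    (((integrable_abs_rpow_gaussian hk).const_mul _).add (integrable_const K))
    (ae_of_all _ fun u => ((continuous_cgfP hp).comp (by fun_prop)).continuousOn)
  rw [Real.norm_of_nonneg (cgfP_nonneg hp _)]
  refine (h _).trans ?_
  rw [abs_mul, Real.mul_rpow (abs_nonneg s) (abs_nonneg u), ← mul_assoc, abs_of_nonneg hs.1]
  have := Real.rpow_le_rpow hs.1 hs.2 hk
  gcongr

lemma integrable_sq_gaussian : Integrable (fun u : ℝ => u ^ 2) (gaussianReal 0 1) := by
  simpa using integrable_abs_rpow_gaussian zero_le_two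

lemma integral_sq_gaussian : ∫ u : ℝ, u ^ 2 ∂(gaussianReal 0 1) = 1 := by
  have h := variance_eq_integral (μ := gaussianReal 0 1) (X := fun u : ℝ => u) (by fun_prop)
  have h2 := variance_fun_id_gaussianReal (μ := 0) (v := 1)
  rw [h2, integral_id_gaussianReal] at h
  simpa using h.symm

lemma average_sq_gaussian (s : ℝ) : ⨍ u : ℝ, s ^ 2 * u ^ 2 ∂(gaussianReal 0 1) = s ^ 2 := by
  rw [average_eq_integral, integral_const_mul, integral_sq_gaussian, mul_one]

lemma sq_gaussian_not_const {s : ℝ} (hs : s ≠ 0) :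
    ¬ ((fun u : ℝ => s ^ 2 * u ^ 2) =ᵐ[gaussianReal 0 1] Function.const ℝ (s ^ 2)) := by
  intro h
  have hna : NullSingletonClass (gaussianReal 0 1) := nullSingletonClass_gaussianReal one_ne_zero
  have h1 : ∀ᵐ u : ℝ ∂(gaussianReal 0 1), u ∈ ({1, -1} : Set ℝ) := by
    filter_upwards [h] with u hu
    have : u ^ 2 = 1 := by
      have hs2 : s ^ 2 ≠ 0 := pow_ne_zero 2 hs
      simpa [hs2] using hu
    rcases mul_self_eq_one_iff.1 ((sq u).symm.trans this) with h | h <;> simp [h]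
  have h2 : ∀ᵐ u : ℝ ∂(gaussianReal 0 1), u ∉ ({1, -1} : Set ℝ) :=
    measure_eq_zero_iff_ae_notMem.1 (Set.Finite.measure_zero (by simp) _)
  obtain ⟨u, hu1, hu2⟩ := (h1.and h2).exists
  exact hu2 hu1

lemma cgfP_sqrt_sq {p : ℝ} (hp : 1 < p) (s u : ℝ) :
    cgfP p √(s ^ 2 * u ^ 2) = cgfP p (s * u) := by
  rw [← mul_pow, Real.sqrt_sq_eq_abs, cgfP_abs hp]

lemma cgfP_lt_gaussCgfP {p s : ℝ} (hp : 1 < p) (hp2 : p < 2) (hs : s ≠ 0) :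
    cgfP p s < gaussCgfP p s := by
  have h := (strictConvexOn_cgfP_sqrt hp hp2).ae_eq_const_or_map_average_lt
    (μ := gaussianReal 0 1) (f := fun u => s ^ 2 * u ^ 2) (continuousOn_cgfP_sqrt hp) isClosed_Ici
    (ae_of_all _ fun u => by simp only [mem_Ici]; positivity) (integrable_sq_gaussian.const_mul _)
    (by simpa [Function.comp_def, cgfP_sqrt_sq hp] using integrable_cgfP_gaussian hp s)
  rw [average_sq_gaussian] at h
  rcases h with h | h
  · exact absurd h (sq_gaussian_not_const hs)
  · simpa [gaussCgfP, average_eq_integral, cgfP_sqrt_sq hp, Real.sqrt_sq_eq_abs,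
      cgfP_abs hp] using h

lemma gaussCgfP_lt_cgfP {p s : ℝ} (hp2 : 2 < p) (hs : s ≠ 0) :
    gaussCgfP p s < cgfP p s := by
  have hp : 1 < p := by linarith
  have h := (strictConcaveOn_cgfP_sqrt hp2).ae_eq_const_or_lt_map_average
    (μ := gaussianReal 0 1) (f := fun u => s ^ 2 * u ^ 2) (continuousOn_cgfP_sqrt hp) isClosed_Ici
    (ae_of_all _ fun u => by simp only [mem_Ici]; positivity) (integrable_sq_gaussian.const_mul _)
    (by simpa [Function.comp_def, cgfP_sqrt_sq hp] using integrable_cgfP_gaussian hp s)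
  rw [average_sq_gaussian] at h
  rcases h with h | h
  · exact absurd h (sq_gaussian_not_const hs)
  · simpa [gaussCgfP, average_eq_integral, cgfP_sqrt_sq hp, Real.sqrt_sq_eq_abs,
      cgfP_abs hp] using h

lemma cgfP_two (s : ℝ) : cgfP 2 s = s ^ 2 / 2 := by
  have h := congrFun (mgf_id_gaussianReal (μ := 0) (v := 1)) s
  rw [mgf] at h
  simp only [id] at h
  rw [cgfP, mgfP, muP_two, h]
  simp

lemma gaussCgfP_two (s : ℝ) : gaussCgfP 2 s = cgfP 2 s := by
  simp_rw [gaussCgfP, cgfP_two, mul_pow, mul_div_right_comm]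
  rw [integral_const_mul, integral_sq_gaussian, mul_one]

/-- The objective whose supremum over `s` and `r > 0` is a rate function. -/
def rateQ (p : ℝ) (K : ℝ → ℝ) (w s r : ℝ) : ℝ := s * r * w + (1 - r ^ p) / p + Real.log r - K s

/-- The supremum of `rateQ`. -/
def rateSup (p : ℝ) (K : ℝ → ℝ) (w : ℝ) : EReal :=
  ⨆ (s : ℝ) (r : ℝ) (_ : 0 < r), (rateQ p K w s r : EReal)

lemma le_rateSup {p : ℝ} {K : ℝ → ℝ} {w s r : ℝ} (hr : 0 < r) :
    (rateQ p K w s r : EReal) ≤ rateSup p K w :=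
  le_iSup_of_le s (le_iSup_of_le r (le_iSup_of_le hr le_rfl))

lemma rateSup_le {p : ℝ} {K : ℝ → ℝ} {w : ℝ} {c : EReal}
    (h : ∀ s r, 0 < r → (rateQ p K w s r : EReal) ≤ c) : rateSup p K w ≤ c :=
  iSup_le fun s => iSup_le fun r => iSup_le fun hr => h s r hr

lemma log_le_rpow_sub_one_div {p r : ℝ} (hp : 0 < p) (hr : 0 < r) :
    Real.log r ≤ (r ^ p - 1) / p := by
  rw [le_div_iff₀ hp, mul_comm, ← Real.log_rpow hr]
  exact Real.log_le_sub_one_of_pos (Real.rpow_pos_of_pos hr p)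

lemma iInf_legendre2_eq_rateSup {p : ℝ} (hp : 1 < p) {L : ℝ × ℝ → EReal} {K : ℝ → ℝ}
    (htop : ∀ t₁ t₂, 1 / p ≤ t₂ → L (t₁, t₂) = ⊤)
    (hL : ∀ s r, 0 < r → L (s * r, (1 - r ^ p) / p) = ((K s - Real.log r : ℝ) : EReal)) (w : ℝ) :
    (⨅ τ ∈ {τ : ℝ × ℝ | 0 < τ.2 ∧ τ.1 * τ.2 ^ (-(1:ℝ)/p) = w}, legendre2 L τ)
      = rateSup p K w := by
  have hp0 : 0 < p := by linarith
  apply le_antisymm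
  · refine (iInf₂_le ((w, 1) : ℝ × ℝ) (by simp)).trans (iSup_le fun t => ?_)
    obtain ⟨t₁, t₂⟩ := t
    by_cases ht : 1 / p ≤ t₂
    · rw [htop _ _ ht]; simp
    · push Not at ht
      have h1 : 0 < 1 - p * t₂ := by
        rw [lt_div_iff₀ hp0] at ht; linarith
      set r := (1 - p * t₂) ^ (1 / p) with hr
      have hrpos : 0 < r := Real.rpow_pos_of_pos h1 _
      have hrp : r ^ p = 1 - p * t₂ := by
        rw [hr, ← Real.rpow_mul h1.le, one_div_mul_cancel hp0.ne', Real.rpow_one]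
      have e1 : t₁ = t₁ / r * r := by field_simp
      have e2 : t₂ = (1 - r ^ p) / p := by rw [hrp]; field_simp; ring
      have : L (t₁, t₂) = ((K (t₁ / r) - Real.log r : ℝ) : EReal) := by
        rw [← hL _ _ hrpos, ← e1, ← e2]
      rw [this, ← EReal.coe_sub]
      refine le_trans (EReal.coe_le_coe_iff.2 (le_of_eq ?_)) (le_rateSup (s := t₁ / r) hrpos)
      rw [rateQ, ← e1, ← e2]; simp only; ring
  · refine le_iInf₂ fun τ hτ => rateSup_le fun s r hr => ?_
    obtain ⟨a, b⟩ := τ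
    obtain ⟨hb, hw⟩ := hτ
    simp only at hb hw
    set c := b ^ (1 / p) with hc
    have hcpos : 0 < c := Real.rpow_pos_of_pos hb _
    have hcp : c ^ p = b := by
      rw [hc, ← Real.rpow_mul hb.le, one_div_mul_cancel hp0.ne', Real.rpow_one]
    have hac : a = w * c := by
      rw [← hw, hc, mul_assoc, ← Real.rpow_add hb, neg_div, neg_add_cancel, Real.rpow_zero, mul_one]
    refine le_trans ?_ (le_iSup _ ((s * (r / c), (1 - (r / c) ^ p) / p) : ℝ × ℝ))
    rw [hL _ _ (div_pos hr hcpos), ← EReal.coe_sub, EReal.coe_le_coe_iff,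
      Real.log_div hr.ne' hcpos.ne', Real.div_rpow hr.le hcpos.le, hcp, hac, rateQ]
    have h1 := log_le_rpow_sub_one_div hp0 hcpos
    rw [hcp] at h1
    have h2 : s * (r / c) * (w * c) + (1 - r ^ p / b) / p * b
        = s * r * w + (1 - r ^ p) / p + (b - 1) / p := by
      field_simp; ring
    simp only [h2]
    linarith

lemma measurable_densP {p : ℝ} (hp : 1 < p) : Measurable (densP p) :=
  (continuous_densP hp).measurable

lemma lintegral_muP (p : ℝ) (hp : 1 < p) {f : ℝ → ℝ≥0∞} (hf : Measurable f) :
    ∫⁻ y, f y ∂(muP p) = ∫⁻ y, ENNReal.ofReal (densP p y) * f y := by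
  rw [muP_eq, lintegral_withDensity_eq_lintegral_mul _ (measurable_densP hp).ennreal_ofReal hf]
  rfl

lemma measurable_exp_lin_rpow (p a b : ℝ) :
    Measurable fun y : ℝ => ENNReal.ofReal (Real.exp (a * y + b * |y| ^ p)) := by
  fun_prop

lemma LamP_eq_top {p : ℝ} (hp : 1 < p) {t₁ t₂ : ℝ} (ht : 1 / p ≤ t₂) : LamP p (t₁, t₂) = ⊤ := by
  have hp0 : 0 < p := by linarith
  have hkey : ∫⁻ y, ENNReal.ofReal (Real.exp (t₁ * y + t₂ * |y| ^ p)) ∂(muP p) = ⊤ := by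
    rw [lintegral_muP p hp (measurable_exp_lin_rpow p t₁ t₂), eq_top_iff]
    set S : Set ℝ := {y | 0 ≤ t₁ * y} with hS
    have hSm : MeasurableSet S := measurableSet_le measurable_const (by fun_prop)
    have hvol : volume S = ⊤ := by
      rcases le_total 0 t₁ with h | h
      · refine eq_top_iff.2 (Real.volume_Ioi (a := 0) ▸ measure_mono fun y hy => ?_)
        exact mul_nonneg h (le_of_lt hy)
      · refine eq_top_iff.2 (Real.volume_Iio (a := 0) ▸ measure_mono fun y hy => ?_)
        exact mul_nonneg_of_nonpos_of_nonpos h (le_of_lt hy)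
    have hZ : 0 < (normZ p)⁻¹ := inv_pos.2 (normZ_pos hp)
    calc (⊤ : ℝ≥0∞) = ∫⁻ _ in S, ENNReal.ofReal (normZ p)⁻¹ := by
          rw [setLIntegral_const, hvol, ENNReal.mul_top]
          simpa using hZ
      _ ≤ ∫⁻ y in S, ENNReal.ofReal (densP p y) *
            ENNReal.ofReal (Real.exp (t₁ * y + t₂ * |y| ^ p)) := by
          refine setLIntegral_mono' hSm fun y hy => ?_
          rw [← ENNReal.ofReal_mul (densP_pos hp y).le]
          apply ENNReal.ofReal_le_ofReal
          rw [densP, mul_assoc, ← Real.exp_add]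
          have h1 : |y| ^ p / p ≤ t₂ * |y| ^ p := by
            have := mul_le_mul_of_nonneg_right ht (Real.rpow_nonneg (abs_nonneg y) p)
            rwa [one_div, inv_mul_eq_div] at this
          have h2 : 0 ≤ t₁ * y := hy
          refine le_mul_of_one_le_right hZ.le (Real.one_le_exp ?_)
          rw [neg_div]; linarith
      _ ≤ _ := setLIntegral_le_lintegral _ _
  rw [LamP, hkey, ENNReal.log_top]

lemma densP_scale {p r : ℝ} (hr : 0 < r) (s y : ℝ) :
    densP p (r * y) * Real.exp (s * (r * y))
      = densP p y * Real.exp (s * r * y + (1 - r ^ p) / p * |y| ^ p) := by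
  rw [densP, densP, mul_assoc, mul_assoc, ← Real.exp_add, ← Real.exp_add, abs_mul, abs_of_pos hr,
    Real.mul_rpow hr.le (abs_nonneg y)]
  congr 2; ring

lemma integral_densP_scale {p r : ℝ} (hp : 1 < p) (hr : 0 < r) (s : ℝ) :
    ∫ y, densP p y * Real.exp (s * r * y + (1 - r ^ p) / p * |y| ^ p) = mgfP p s / r := by
  simp_rw [← densP_scale hr]
  rw [Measure.integral_comp_mul_left (fun x => densP p x * Real.exp (s * x)), mgfP,
    integral_muP hp, abs_of_pos (inv_pos.2 hr), smul_eq_mul]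
  ring

lemma integrable_densP_scale {p r : ℝ} (hp : 1 < p) (hr : 0 < r) (s : ℝ) :
    Integrable fun y => densP p y * Real.exp (s * r * y + (1 - r ^ p) / p * |y| ^ p) := by
  simp_rw [← densP_scale hr]
  exact ((integrable_muP_iff hp).1 (integrable_exp_muP hp s)).comp_mul_left' hr.ne'

lemma LamP_eq {p r : ℝ} (hp : 1 < p) (s : ℝ) (hr : 0 < r) :
    LamP p (s * r, (1 - r ^ p) / p) = ((cgfP p s - Real.log r : ℝ) : EReal) := by
  have h : ∫⁻ y, ENNReal.ofReal (Real.exp (s * r * y + (1 - r ^ p) / p * |y| ^ p)) ∂(muP p)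
      = ENNReal.ofReal (mgfP p s / r) := by
    rw [lintegral_muP p hp (measurable_exp_lin_rpow p _ _), ← integral_densP_scale hp hr,
      ofReal_integral_eq_lintegral_ofReal (integrable_densP_scale hp hr s)
        (ae_of_all _ fun y => mul_nonneg (densP_pos hp y).le (Real.exp_pos _).le)]
    exact lintegral_congr fun y => (ENNReal.ofReal_mul (densP_pos hp y).le).symm
  rw [LamP, h, ENNReal.log_ofReal_of_pos (div_pos (mgfP_pos hp s) hr),
    Real.log_div (mgfP_pos hp s).ne' hr.ne', cgfP]

lemma Icr_eq {p : ℝ} (hp : 1 < p) (w : ℝ) : Icr p w = rateSup p (cgfP p) w :=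
  iInf_legendre2_eq_rateSup hp (fun _ _ h => LamP_eq_top hp h) (fun s _ hr => LamP_eq hp s hr) w

lemma eIntegral_coe {ν : Measure ℝ} {f : ℝ → ℝ} (hf : Integrable f ν) :
    eIntegral ν (fun u => (f u : EReal)) = ((∫ u, f u ∂ν : ℝ) : EReal) := by
  have h1 : ∀ x : ℝ, erealToENNReal x = ENNReal.ofReal x := fun x => by simp [erealToENNReal]
  have h2 : ∫⁻ u, ENNReal.ofReal (f u) ∂ν ≠ ⊤ := hf.lintegral_lt_top.ne
  have h3 : ∫⁻ u, ENNReal.ofReal (-f u) ∂ν ≠ ⊤ := hf.neg.lintegral_lt_top.ne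
  rw [eIntegral, integral_eq_lintegral_pos_part_sub_lintegral_neg_part hf]
  simp_rw [← EReal.coe_neg, h1]
  rw [EReal.coe_sub, EReal.coe_ennreal_toReal h2, EReal.coe_ennreal_toReal h3]

lemma Psi_eq_top {p : ℝ} (hp : 1 < p) {ν : Measure ℝ} [IsProbabilityMeasure ν] {t₁ t₂ : ℝ}
    (ht : 1 / p ≤ t₂) : Psi p ν (t₁, t₂) = ⊤ := by
  simp [Psi, eIntegral, LamP_eq_top hp ht, erealToENNReal]

lemma Psi_gaussian_eq {p r : ℝ} (hp : 1 < p) (s : ℝ) (hr : 0 < r) :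
    Psi p (muP 2) (s * r, (1 - r ^ p) / p) = ((gaussCgfP p s - Real.log r : ℝ) : EReal) := by
  have h : ∀ u, LamP p (s * r * u, (1 - r ^ p) / p)
      = ((cgfP p (s * u) - Real.log r : ℝ) : EReal) := fun u => by
    rw [← LamP_eq hp _ hr]; congr 2; ring
  simp only [Psi, h, muP_two]
  have hi : Integrable (fun u => cgfP p (s * u) - Real.log r) (gaussianReal 0 1) :=
    (integrable_cgfP_gaussian hp s).sub (integrable_const _)
  rw [eIntegral_coe hi, integral_sub (integrable_cgfP_gaussian hp s) (integrable_const _)]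
  simp [gaussCgfP]

lemma Iq_eq {p : ℝ} (hp : 1 < p) (w : ℝ) : Iq p (muP 2) w = rateSup p (gaussCgfP p) w := by
  have := isProbabilityMeasure_muP (p := 2) (by norm_num)
  exact iInf_legendre2_eq_rateSup hp (fun _ _ h => Psi_eq_top hp h)
    (fun s _ hr => Psi_gaussian_eq hp s hr) w

lemma rateQ_neg {p : ℝ} {K : ℝ → ℝ} (hK : ∀ s, K (-s) = K s) (w s r : ℝ) :
    rateQ p K (-w) (-s) r = rateQ p K w s r := by
  simp [rateQ, hK]

lemma rateSup_neg {p : ℝ} {K : ℝ → ℝ} (hK : ∀ s, K (-s) = K s) (w : ℝ) :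
    rateSup p K (-w) = rateSup p K w := by
  have h : ∀ w, rateSup p K (-w) ≤ rateSup p K w := fun w => rateSup_le fun s r hr => by
    have := rateQ_neg (p := p) hK w (-s) r
    rw [neg_neg] at this
    rw [this]; exact le_rateSup hr
  refine le_antisymm (h w) ?_
  simpa using h (-w)

lemma rateSup_abs {p : ℝ} {K : ℝ → ℝ} (hK : ∀ s, K (-s) = K s) (w : ℝ) :
    rateSup p K |w| = rateSup p K w := by
  rcases abs_choice w with h | h <;> rw [h]
  exact rateSup_neg hK w

lemma gaussCgfP_neg {p : ℝ} (hp : 1 < p) (s : ℝ) : gaussCgfP p (-s) = gaussCgfP p s := by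
  simp [gaussCgfP, neg_mul, cgfP_neg hp]

lemma radial_nonpos {p r : ℝ} (hp : 0 < p) (hr : 0 < r) : (1 - r ^ p) / p + Real.log r ≤ 0 := by
  have h := log_le_rpow_sub_one_div hp hr
  have : (1 - r ^ p) / p = -((r ^ p - 1) / p) := by ring
  linarith

lemma rateSup_nonneg {p : ℝ} {K : ℝ → ℝ} (h0 : K 0 = 0) (w : ℝ) : 0 ≤ rateSup p K w := by
  refine le_trans (le_of_eq ?_) (le_rateSup (s := 0) (r := 1) one_pos)
  simp [rateQ, h0]

lemma rateSup_zero {p : ℝ} (hp : 0 < p) {K : ℝ → ℝ} (h0 : K 0 = 0) (hK : ∀ s, 0 ≤ K s) :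
    rateSup p K 0 = 0 := by
  refine le_antisymm (rateSup_le fun s r hr => ?_) (rateSup_nonneg h0 0)
  rw [← EReal.coe_zero, EReal.coe_le_coe_iff, rateQ]
  have := radial_nonpos hp hr
  linarith [hK s]

lemma lowerSemicontinuous_rateSup (p : ℝ) (K : ℝ → ℝ) : LowerSemicontinuous (rateSup p K) := by
  refine lowerSemicontinuous_iSup fun s => lowerSemicontinuous_iSup fun r =>
    lowerSemicontinuous_iSup fun _ => Continuous.lowerSemicontinuous ?_
  exact continuous_coe_real_ereal.comp (by unfold rateQ; fun_prop)

lemma convex_rateSup_le (p : ℝ) (K : ℝ → ℝ) (c : EReal) : Convex ℝ {x | rateSup p K x ≤ c} := by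
  intro x hx y hy a b ha hb hab
  refine rateSup_le fun s r hr => ?_
  have h1 : (rateQ p K x s r : EReal) ≤ c := (le_rateSup hr).trans hx
  have h2 : (rateQ p K y s r : EReal) ≤ c := (le_rateSup hr).trans hy
  have h3 : rateQ p K (a • x + b • y) s r = a * rateQ p K x s r + b * rateQ p K y s r := by
    simp only [rateQ, smul_eq_mul]
    have : b = 1 - a := by linarith
    subst this; ring
  have h4 : rateQ p K (a • x + b • y) s r ≤ max (rateQ p K x s r) (rateQ p K y s r) := by
    rw [h3]
    calc a * rateQ p K x s r + b * rateQ p K y s r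
        ≤ a * max (rateQ p K x s r) (rateQ p K y s r)
          + b * max (rateQ p K x s r) (rateQ p K y s r) := by
          gcongr
          · exact le_max_left _ _
          · exact le_max_right _ _
      _ = _ := by rw [← add_mul, hab, one_mul]
  refine (EReal.coe_le_coe_iff.2 h4).trans ?_
  rcases max_choice (rateQ p K x s r) (rateQ p K y s r) with h | h <;> rw [h] <;> assumption

lemma isCompact_rateSup_le (p : ℝ) (K : ℝ → ℝ) (c : ℝ) :
    IsCompact {x | rateSup p K x ≤ (c : EReal)} := by
  refine Metric.isCompact_of_isClosed_isBounded
    ((lowerSemicontinuous_rateSup p K).isClosed_preimage _) ?_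
  refine (Metric.isBounded_Icc (-(c + K (-1))) (c + K 1)).subset fun x hx => ?_
  have h1 : (rateQ p K x 1 1 : EReal) ≤ c := (le_rateSup one_pos).trans hx
  have h2 : (rateQ p K x (-1) 1 : EReal) ≤ c := (le_rateSup one_pos).trans hx
  rw [EReal.coe_le_coe_iff] at h1 h2
  simp only [rateQ, Real.one_rpow, Real.log_one] at h1 h2
  constructor <;> simp at h1 h2 <;> linarith

lemma rateQ_le_of_tilt {p w s r s' r' : ℝ} (hp : 1 < p) (hr : 0 < r) (hr' : 0 < r')
    (hA : mgfPabs p s / mgfP p s = r ^ p) (hm : mgfP₁ p s / mgfP p s = r * w) :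
    rateQ p (cgfP p) w s' r' ≤ rateQ p (cgfP p) w s r := by
  have hp0 : 0 < p := by linarith
  set ρ := r' / r with hρ
  have hρpos : 0 < ρ := div_pos hr' hr
  have hM := mgfP_pos hp s
  rw [div_eq_iff hM.ne'] at hA hm
  set d := s' * ρ - s with hd
  set e := (1 - ρ ^ p) / p with he
  set a := d * (r * w) + e * r ^ p with ha
  have i0 := integrable_exp_muP hp s
  have i1 := integrable_mul_exp_muP hp s
  have i2 := integrable_abs_rpow_exp_muP hp hp0.le s
  have key : Real.exp a * mgfP p s ≤ mgfP p s' / ρ := by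
    have hi2 : Integrable (fun y => Real.exp (s' * ρ * y + (1 - ρ ^ p) / p * |y| ^ p)) (muP p) :=
      (integrable_muP_iff hp).2 (integrable_densP_scale hp hρpos s')
    have hi1 : Integrable (fun y => Real.exp a * ((1 - a) * Real.exp (s * y)
        + d * (y * Real.exp (s * y)) + e * (|y| ^ p * Real.exp (s * y)))) (muP p) :=
      (((i0.const_mul _).add (i1.const_mul _)).add (i2.const_mul _)).const_mul _
    have hi01 : Integrable (fun y => (1 - a) * Real.exp (s * y) + d * (y * Real.exp (s * y)))
        (muP p) := (i0.const_mul _).add (i1.const_mul _)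
    rw [← integral_densP_scale hp hρpos s', ← integral_muP hp]
    refine le_trans (le_of_eq ?_) (integral_mono hi1 hi2 fun y => ?_)
    · rw [integral_const_mul, integral_add hi01 (i2.const_mul _),
        integral_add (i0.const_mul _) (i1.const_mul _), integral_const_mul, integral_const_mul,
        integral_const_mul]
      change _ = Real.exp a * ((1 - a) * mgfP p s + d * mgfP₁ p s + e * mgfPabs p s)
      rw [hA, hm, ha]; ring
    · simp only
      have h1 : s' * ρ * y + (1 - ρ ^ p) / p * |y| ^ p
          = a + s * y + (d * y + e * |y| ^ p - a) := by rw [hd, he]; ring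
      rw [h1, Real.exp_add (a + s * y), Real.exp_add a]
      have h2 := Real.add_one_le_exp (d * y + e * |y| ^ p - a)
      have h3 := mul_le_mul_of_nonneg_left h2 (mul_pos (Real.exp_pos a) (Real.exp_pos (s * y))).le
      refine le_trans (le_of_eq ?_) h3
      ring
  have hlog := Real.log_le_log (mul_pos (Real.exp_pos a) hM) key
  rw [Real.log_mul (Real.exp_pos a).ne' hM.ne', Real.log_exp,
    Real.log_div (mgfP_pos hp s').ne' hρpos.ne', hρ, Real.log_div hr'.ne' hr.ne'] at hlog
  have ha' : a = s' * r' * w - s * r * w + (r ^ p - r' ^ p) / p := by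
    rw [ha, hd, he, hρ, Real.div_rpow hr'.le hr.le]
    have := Real.rpow_pos_of_pos hr p
    field_simp
  have h5 : (1 - r' ^ p) / p = (1 - r ^ p) / p + (r ^ p - r' ^ p) / p := by ring
  simp only [rateQ, cgfP]
  rw [h5]
  linarith

lemma rateSup_cgfP_eq_of_tilt {p w s r : ℝ} (hp : 1 < p) (hr : 0 < r)
    (hA : mgfPabs p s / mgfP p s = r ^ p) (hm : mgfP₁ p s / mgfP p s = r * w) :
    rateSup p (cgfP p) w = (rateQ p (cgfP p) w s r : EReal) :=
  le_antisymm (rateSup_le fun _ _ hr' => EReal.coe_le_coe_iff.2 (rateQ_le_of_tilt hp hr hr' hA hm))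
    (le_rateSup hr)

lemma rateSup_cgfP_eq_top {p w : ℝ} (hp : 1 < p) (hw : 1 < |w|) : rateSup p (cgfP p) w = ⊤ := by
  have hp0 : 0 < p := by linarith
  rw [← rateSup_abs (cgfP_neg hp), EReal.eq_top_iff_forall_lt]
  intro y
  obtain ⟨c, hc⟩ : ∃ c, c = max 0 (y / (|w| - 1)) + 1 := ⟨_, rfl⟩
  have hc0 : 0 < c := by rw [hc]; linarith [le_max_left 0 (y / (|w| - 1))]
  have hcy : y < c * (|w| - 1) := by
    rw [← div_lt_iff₀ (by linarith)]
    rw [hc]; linarith [le_max_right 0 (y / (|w| - 1))]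
  obtain ⟨r, hr⟩ : ∃ r, r = (c + 1) ^ (1 / p) := ⟨_, rfl⟩
  have hrpos : 0 < r := by rw [hr]; positivity
  have hrp : r ^ p = c + 1 := by
    rw [hr, ← Real.rpow_mul (by linarith), one_div_mul_cancel hp0.ne', Real.rpow_one]
  refine lt_of_lt_of_le (EReal.coe_lt_coe_iff.2 ?_) (le_rateSup (s := c / r) hrpos)
  have key : mgfP p (c / r) / r ≤ Real.exp (c * (1 - 1 / p)) := by
    have hprob := isProbabilityMeasure_muP hp
    rw [← integral_densP_scale hp hrpos, ← integral_muP hp]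
    have hi := (integrable_muP_iff hp).2 (integrable_densP_scale hp hrpos (c / r))
    refine (integral_mono hi (integrable_const (Real.exp (c * (1 - 1 / p)))) fun y => ?_).trans_eq
      (by simp)
    simp only
    gcongr
    rw [hrp, div_mul_cancel₀ _ hrpos.ne']
    have hyoung : y ≤ |y| ^ p / p + (1 - 1 / p) := by
      have h1 := Real.add_one_le_exp (Real.log (|y| ^ p))
      rcases eq_or_ne y 0 with rfl | hy
      · have : 1 / p ≤ 1 := by rw [div_le_one hp0]; exact hp.le
        have : 0 ≤ |(0:ℝ)| ^ p / p := by positivity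
        linarith
      · have hbern := one_add_mul_self_le_rpow_one_add (s := |y| - 1)
          (by linarith [abs_nonneg y]) hp.le
        rw [add_sub_cancel] at hbern
        have : |y| ≤ |y| ^ p / p + (1 - 1 / p) := by
          have h3 : (1 + p * (|y| - 1)) / p ≤ |y| ^ p / p := by gcongr
          have h4 : (1 + p * (|y| - 1)) / p = 1 / p + |y| - 1 := by field_simp; ring
          linarith
        exact (le_abs_self y).trans this
    have h6 := mul_le_mul_of_nonneg_left hyoung hc0.le
    have h7 : (1 - (c + 1)) / p * |y| ^ p = - (c * (|y| ^ p / p)) := by ring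
    rw [h7]; linarith
  have hlog := Real.log_le_log (div_pos (mgfP_pos hp _) hrpos) key
  rw [Real.log_exp, Real.log_div (mgfP_pos hp _).ne' hrpos.ne'] at hlog
  rw [rateQ, hrp, div_mul_cancel₀ _ hrpos.ne', cgfP]
  have h8 : (1 - (c + 1)) / p = - (c * (1 / p)) := by ring
  rw [h8]; nlinarith

lemma exists_rateSup_cgfP_eq {p w : ℝ} (hp : 1 < p) (hw : w ∈ Ioo (-1) 1) :
    ∃ s r, 0 < r ∧ mgfPabs p s / mgfP p s = r ^ p ∧ mgfP₁ p s / mgfP p s = r * w ∧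
      rateSup p (cgfP p) w = (rateQ p (cgfP p) w s r : EReal) := by
  obtain ⟨s, r, hr, hA, hm⟩ := exists_tilt hp hw
  exact ⟨s, r, hr, hA, hm, rateSup_cgfP_eq_of_tilt hp hr hA hm⟩

lemma rateSup_mono {p : ℝ} {K K' : ℝ → ℝ} (h : ∀ s, K' s ≤ K s) (w : ℝ) :
    rateSup p K w ≤ rateSup p K' w :=
  rateSup_le fun s r hr => (EReal.coe_le_coe_iff.2 (by
    have := h s
    simp only [rateQ]; linarith)).trans (le_rateSup (s := s) hr)

lemma rateSup_cgfP_lt {p w : ℝ} {K : ℝ → ℝ} (hp : 1 < p) (hw : w ∈ Ioo (-1) 1) (hw0 : w ≠ 0)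
    (h : ∀ s, s ≠ 0 → K s < cgfP p s) : rateSup p (cgfP p) w < rateSup p K w := by
  obtain ⟨s, r, hr, hA, hm, he⟩ := exists_rateSup_cgfP_eq hp hw
  have hs : s ≠ 0 := by
    rintro rfl
    rw [mgfP₁_zero hp, zero_div] at hm
    rcases mul_eq_zero.1 hm.symm with h | h
    · exact hr.ne' h
    · exact hw0 h
  rw [he]
  refine lt_of_lt_of_le (EReal.coe_lt_coe_iff.2 ?_) (le_rateSup (s := s) hr)
  have := h s hs
  simp only [rateQ]; linarith

lemma exists_rateQ_cgfP_pos {p w : ℝ} (hp : 1 < p) (hw : w ≠ 0) :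
    ∃ s, 0 < rateQ p (cgfP p) w s 1 := by
  by_contra! hcon
  simp only [rateQ, Real.one_rpow, Real.log_one, sub_self, zero_div, mul_one, add_zero] at hcon
  have hd : HasDerivAt (fun s => s * w - cgfP p s) (w - mgfP₁ p 0 / mgfP p 0) 0 := by
    have h1 : HasDerivAt (cgfP p) (mgfP₁ p 0 / mgfP p 0) 0 :=
      (hasDerivAt_mgfP hp 0).log (mgfP_pos hp 0).ne'
    exact (hasDerivAt_mul_const w).sub h1
  have hmax : IsLocalMax (fun s => s * w - cgfP p s) 0 :=
    Filter.Eventually.of_forall fun s => by simpa [cgfP_zero hp] using hcon s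
  have := hmax.hasDerivAt_eq_zero hd
  rw [mgfP₁_zero hp, zero_div, sub_zero] at this
  exact hw this

lemma radial_le {p r : ℝ} (hp : 0 < p) (hr : 0 < r) :
    (1 - r ^ p) / p + Real.log r ≤ (1 + Real.log 2 - r ^ p / 2) / p := by
  have hpos := Real.rpow_pos_of_pos hr p
  have h1 := Real.log_le_sub_one_of_pos (half_pos hpos)
  rw [Real.log_div hpos.ne' two_ne_zero, Real.log_rpow hr] at h1
  have h2 : Real.log r ≤ (Real.log 2 + r ^ p / 2) / p := by
    rw [le_div_iff₀ hp]; linarith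
  have h3 : (1 + Real.log 2 - r ^ p / 2) / p = (1 - r ^ p) / p + (Real.log 2 + r ^ p / 2) / p := by
    ring
  linarith

lemma rateSup_lt_cgfP_of_pos {p w : ℝ} {K : ℝ → ℝ} (hp : 1 < p) (hw0 : 0 < w) (hw1 : w < 1)
    (hK : ∀ s, 0 ≤ K s) (hKc : ∀ S, ContinuousOn K (Icc 0 S)) (hKle : ∀ s, cgfP p s ≤ K s)
    (h : ∀ s, s ≠ 0 → cgfP p s < K s) : rateSup p K w < rateSup p (cgfP p) w := by
  have hp0 : 0 < p := by linarith
  obtain ⟨_, _, _, -, -, he⟩ := exists_rateSup_cgfP_eq hp (w := w) ⟨by linarith, hw1⟩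
  obtain ⟨_, _, _, -, -, he'⟩ := exists_rateSup_cgfP_eq hp (w := (1 + w) / 2)
    ⟨by linarith, by linarith⟩
  set I₀ := rateQ p (cgfP p) w _ _
  set I₂ := rateQ p (cgfP p) ((1 + w) / 2) _ _
  have hle : ∀ s r, 0 < r → rateQ p (cgfP p) w s r ≤ I₀ := fun s r hr =>
    EReal.coe_le_coe_iff.1 (he ▸ le_rateSup hr)
  have hle₂ : ∀ s r, 0 < r → rateQ p (cgfP p) ((1 + w) / 2) s r ≤ I₂ := fun s r hr =>
    EReal.coe_le_coe_iff.1 (he' ▸ le_rateSup hr)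
  have hI₀ : 0 < I₀ := by
    obtain ⟨s, hs⟩ := exists_rateQ_cgfP_pos hp hw0.ne'
    exact hs.trans_le (hle s 1 one_pos)
  have hKQ : ∀ s r, rateQ p K w s r = rateQ p (cgfP p) w s r - (K s - cgfP p s) := fun s r => by
    simp only [rateQ]; ring
  obtain ⟨M, hM⟩ : ∃ M, M = max 1 (I₂ / ((1 - w) / 2)) := ⟨_, rfl⟩
  have hM1 : 1 ≤ M := hM ▸ le_max_left _ _
  have hM2 : I₂ ≤ M * ((1 - w) / 2) := by
    rw [← div_le_iff₀ (by linarith)]; exact hM ▸ le_max_right _ _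
  have hbig : ∀ s r, 0 < r → M ≤ s * r → rateQ p K w s r ≤ 0 := fun s r hr hsr => by
    have h1 := hle₂ s r hr
    have h2 : rateQ p (cgfP p) w s r
        = rateQ p (cgfP p) ((1 + w) / 2) s r - s * r * ((1 - w) / 2) := by
      simp only [rateQ]; ring
    have h3 : M * ((1 - w) / 2) ≤ s * r * ((1 - w) / 2) := by gcongr
    rw [hKQ]; linarith [hKle s]
  have hneg : ∀ s r, 0 < r → s ≤ 0 → rateQ p K w s r ≤ 0 := fun s r hr hs => by
    have h1 := radial_nonpos hp0 hr
    have h2 : s * r * w ≤ 0 :=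
      mul_nonpos_of_nonpos_of_nonneg (mul_nonpos_of_nonpos_of_nonneg hs hr.le) hw0.le
    simp only [rateQ]; linarith [hK s]
  have hmid : ∀ s r, s * r < M → rateQ p K w s r ≤ M + ((1 - r ^ p) / p + Real.log r) :=
    fun s r hsr => by
      have : s * r * w ≤ M := by nlinarith
      simp only [rateQ]; linarith [hK s]
  obtain ⟨R, hR⟩ : ∃ R, R = (2 * (1 + Real.log 2 + M * p)) ^ (1 / p) := ⟨_, rfl⟩
  have hlog2 : 0 < Real.log 2 := Real.log_pos one_lt_two
  have hRbase : 0 < 2 * (1 + Real.log 2 + M * p) := by positivity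
  have hRpos : 0 < R := by rw [hR]; positivity
  have hRp : R ^ p = 2 * (1 + Real.log 2 + M * p) := by
    rw [hR, ← Real.rpow_mul hRbase.le, one_div_mul_cancel hp0.ne', Real.rpow_one]
  have hRbig : ∀ s r, R ≤ r → s * r < M → rateQ p K w s r ≤ 0 := fun s r hr hsr => by
    have h1 := radial_le hp0 (hRpos.trans_le hr)
    have h2 : R ^ p ≤ r ^ p := Real.rpow_le_rpow hRpos.le hr hp0.le
    have h3 : (1 + Real.log 2 - r ^ p / 2) / p ≤ -M := by
      rw [div_le_iff₀ hp0]; linarith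
    linarith [hmid s r hsr]
  obtain ⟨r₀, hr₀⟩ : ∃ r₀, r₀ = Real.exp (-(M + 1 / p)) := ⟨_, rfl⟩
  have hr₀pos : 0 < r₀ := hr₀ ▸ Real.exp_pos _
  have hsmall : ∀ s r, 0 < r → r ≤ r₀ → s * r < M → rateQ p K w s r ≤ 0 := fun s r hr hrr hsr => by
    have h1 : Real.log r ≤ -(M + 1 / p) := by
      rw [← Real.log_exp (-(M + 1 / p)), ← hr₀]; exact Real.log_le_log hr hrr
    have h2 : (1 - r ^ p) / p ≤ 1 / p := by
      gcongr; linarith [Real.rpow_pos_of_pos hr p]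
    linarith [hmid s r hsr]
  obtain ⟨ε, hε⟩ : ∃ ε, ε = I₀ / (2 * R) := ⟨_, rfl⟩
  have hεpos : 0 < ε := by rw [hε]; positivity
  obtain ⟨δ, hδ, hgap⟩ : ∃ δ > 0, ∀ s ∈ Icc ε (M / r₀), δ ≤ K s - cgfP p s := by
    rcases (Icc ε (M / r₀)).eq_empty_or_nonempty with hemp | hne
    · exact ⟨1, one_pos, fun s hs => by simp [hemp] at hs⟩
    · have hc : ContinuousOn (fun s => K s - cgfP p s) (Icc ε (M / r₀)) :=
        ((hKc _).mono (Icc_subset_Icc_left hεpos.le)).sub (continuous_cgfP hp).continuousOn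
      obtain ⟨s₀, hs₀, hmin⟩ := isCompact_Icc.exists_isMinOn hne hc
      exact ⟨K s₀ - cgfP p s₀, sub_pos.2 (h s₀ (hεpos.trans_le hs₀.1).ne'), fun s hs => hmin hs⟩
  rw [he]
  refine lt_of_le_of_lt (b := ((max (I₀ / 2) (I₀ - δ) : ℝ) : EReal)) (rateSup_le fun s r hr => ?_)
    (EReal.coe_lt_coe_iff.2 (max_lt (by linarith) (by linarith)))
  rw [EReal.coe_le_coe_iff]
  have hz : ∀ {x : ℝ}, x ≤ 0 → x ≤ max (I₀ / 2) (I₀ - δ) := fun hx =>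
    le_max_of_le_left (by linarith)
  rcases le_or_gt s 0 with hs | hs
  · exact hz (hneg s r hr hs)
  rcases le_or_gt M (s * r) with hsr | hsr
  · exact hz (hbig s r hr hsr)
  rcases le_or_gt R r with hRr | hRr
  · exact hz (hRbig s r hRr hsr)
  rcases le_or_gt r r₀ with hrr | hrr
  · exact hz (hsmall s r hr hrr hsr)
  rcases le_or_gt s ε with hsε | hsε
  · refine le_max_of_le_left ?_
    have h1 := radial_nonpos hp0 hr
    have h2 : s * r * w ≤ ε * R * 1 := by gcongr
    have h3 : ε * R * 1 = I₀ / 2 := by rw [hε]; field_simp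
    simp only [rateQ]; linarith [hK s]
  · refine le_max_of_le_right ?_
    have h1 : s ≤ M / r₀ := by
      rw [le_div_iff₀ hr₀pos]; nlinarith
    rw [hKQ]; linarith [hle s r hr, hgap s ⟨hsε.le, h1⟩]

lemma rateSup_lt_cgfP {p w : ℝ} {K : ℝ → ℝ} (hp : 1 < p) (hw : w ∈ Ioo (-1) 1) (hw0 : w ≠ 0)
    (hKn : ∀ s, K (-s) = K s) (hK : ∀ s, 0 ≤ K s) (hKc : ∀ S, ContinuousOn K (Icc 0 S))
    (hKle : ∀ s, cgfP p s ≤ K s) (h : ∀ s, s ≠ 0 → cgfP p s < K s) :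
    rateSup p K w < rateSup p (cgfP p) w := by
  rw [← rateSup_abs hKn, ← rateSup_abs (cgfP_neg hp)]
  exact rateSup_lt_cgfP_of_pos hp (abs_pos.2 hw0) (abs_lt.2 hw) hK hKc hKle h

lemma Iq_Icr_compare {p w : ℝ} (hp : 1 < p) (hw : w ∈ Ioo (-1) 1) :
    (2 < p → Icr p w ≤ Iq p (muP 2) w ∧ (Iq p (muP 2) w = Icr p w ↔ w = 0))
      ∧ (p = 2 → Iq p (muP 2) w = Icr p w)
      ∧ (p < 2 → Iq p (muP 2) w ≤ Icr p w ∧ (Iq p (muP 2) w = Icr p w ↔ w = 0)) := by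
  have hp0 : 0 < p := by linarith
  rw [Iq_eq hp, Icr_eq hp]
  have h0 : w = 0 → rateSup p (gaussCgfP p) w = rateSup p (cgfP p) w := by
    rintro rfl
    rw [rateSup_zero hp0 (gaussCgfP_zero hp) (gaussCgfP_nonneg hp),
      rateSup_zero hp0 (cgfP_zero hp) (cgfP_nonneg hp)]
  have hzero : gaussCgfP p 0 = cgfP p 0 := by rw [gaussCgfP_zero hp, cgfP_zero hp]
  refine ⟨fun h => ⟨rateSup_mono (fun s => ?_) w, fun he => ?_, h0⟩, ?_,
    fun h => ⟨rateSup_mono (fun s => ?_) w, fun he => ?_, h0⟩⟩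
  · rcases eq_or_ne s 0 with rfl | hs
    · exact hzero.le
    · exact (gaussCgfP_lt_cgfP h hs).le
  · by_contra hw0
    exact (rateSup_cgfP_lt hp hw hw0 fun s hs => gaussCgfP_lt_cgfP h hs).ne' he
  · rintro rfl
    rw [funext gaussCgfP_two]
  · rcases eq_or_ne s 0 with rfl | hs
    · exact hzero.ge
    · exact (cgfP_lt_gaussCgfP hp h hs).le
  · by_contra hw0
    refine (rateSup_lt_cgfP hp hw hw0 (gaussCgfP_neg hp) (gaussCgfP_nonneg hp)
      (continuousOn_gaussCgfP hp) (fun s => ?_) fun s hs => cgfP_lt_gaussCgfP hp h hs).ne he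
    rcases eq_or_ne s 0 with rfl | hs
    · exact hzero.ge
    · exact (cgfP_lt_gaussCgfP hp h hs).le

lemma lintegral_ofReal_prod {ι : Type*} [Fintype ι] {f : ι → ℝ → ℝ} (hf : ∀ i, Integrable (f i))
    (h0 : ∀ i x, 0 ≤ f i x) :
    ∫⁻ x : ι → ℝ, ENNReal.ofReal (∏ i, f i (x i)) = ∏ i, ∫⁻ x, ENNReal.ofReal (f i x) := by
  have hi : Integrable (fun x : ι → ℝ => ∏ i, f i (x i)) := Integrable.fintype_prod hf
  rw [← ofReal_integral_eq_lintegral_ofReal hi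
    (ae_of_all _ fun x => Finset.prod_nonneg fun i _ => h0 i _),
    integral_fintype_prod_volume_eq_prod,
    ENNReal.ofReal_prod_of_nonneg fun i _ => integral_nonneg (h0 i)]
  exact Finset.prod_congr rfl fun i _ =>
    ofReal_integral_eq_lintegral_ofReal (hf i) (ae_of_all _ (h0 i))

lemma pi_withDensity_ofReal {ι : Type*} [Fintype ι] {f : ℝ → ℝ} (hf : Integrable f)
    (h0 : ∀ x, 0 ≤ f x) :
    Measure.pi (fun _ : ι => volume.withDensity fun x => ENNReal.ofReal (f x))
      = volume.withDensity fun x : ι → ℝ => ENNReal.ofReal (∏ i, f (x i)) := by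
  have := isFiniteMeasure_withDensity_ofReal hf.2
  refine Measure.pi_eq fun s hs => ?_
  have hprod : MeasurableSet (pi univ s) := MeasurableSet.univ_pi hs
  rw [withDensity_apply _ hprod, ← lintegral_indicator hprod]
  have h1 : (pi univ s).indicator (fun x : ι → ℝ => ENNReal.ofReal (∏ i, f (x i)))
      = fun x => ENNReal.ofReal (∏ i, (s i).indicator f (x i)) := by
    classical
    ext x
    by_cases hx : x ∈ pi univ s
    · rw [indicator_of_mem hx]
      congr 1
      exact Finset.prod_congr rfl fun i _ => (indicator_of_mem (hx i (mem_univ i)) f).symm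
    · rw [indicator_of_notMem hx]
      simp only [mem_univ_pi, not_forall] at hx
      obtain ⟨i, hi⟩ := hx
      rw [Finset.prod_eq_zero (Finset.mem_univ i) (indicator_of_notMem hi f), ENNReal.ofReal_zero]
  rw [h1, lintegral_ofReal_prod (fun i => hf.indicator (hs i))
    fun i x => indicator_nonneg (fun y _ => h0 y) x]
  refine Finset.prod_congr rfl fun i _ => ?_
  rw [withDensity_apply _ (hs i), ← lintegral_indicator (hs i)]
  refine lintegral_congr fun x => ?_
  by_cases hx : x ∈ s i <;> simp [hx]

lemma tendsto_pi_deviation {ν : Measure ℝ} [IsProbabilityMeasure ν] {g : ℝ → ℝ}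
    (hg : MemLp g 2 ν) {η : ℝ} (hη : 0 < η) :
    Tendsto (fun n : ℕ => Measure.pi (fun _ : Fin n => ν)
      {x | η ≤ |(∑ i, g (x i)) / n - ∫ y, g y ∂ν|}) atTop (𝓝 0) := by
  have hlim : Tendsto (fun n : ℕ => ENNReal.ofReal (variance g ν / η ^ 2 / n)) atTop (𝓝 0) := by
    rw [← ENNReal.ofReal_zero]
    exact ENNReal.tendsto_ofReal (tendsto_const_div_atTop_nhds_zero_nat _)
  refine tendsto_of_tendsto_of_tendsto_of_le_of_le' tendsto_const_nhds hlim
    (Eventually.of_forall fun _ => zero_le) ?_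
  filter_upwards [eventually_gt_atTop 0] with n hn
  have hn' : (0 : ℝ) < n := Nat.cast_pos.2 hn
  have hgi : ∀ i : Fin n, MemLp (fun x : Fin n → ℝ => g (x i)) 2 (Measure.pi fun _ => ν) :=
    fun i => hg.comp_measurePreserving (measurePreserving_eval _ i)
  have hS : MemLp (∑ i, fun x : Fin n → ℝ => g (x i)) 2 (Measure.pi fun _ => ν) :=
    memLp_finsetSum' _ fun i _ => hgi i
  have hvar := variance_sum_pi (ι := Fin n) (μ := fun _ => ν) (X := fun _ => g) fun _ => hg
  have hmean : ∫ x, (∑ i, fun x : Fin n → ℝ => g (x i)) x ∂(Measure.pi fun _ => ν)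
      = n * ∫ y, g y ∂ν := by
    simp only [Finset.sum_apply]
    rw [integral_finsetSum _ fun i _ => (hgi i).integrable one_le_two]
    have : ∀ i : Fin n, ∫ x : Fin n → ℝ, g (x i) ∂(Measure.pi fun _ => ν) = ∫ y, g y ∂ν :=
      fun i => integral_comp_eval (μ := fun _ : Fin n => ν) (i := i) hg.1
    simp [this]
  have h := meas_ge_le_variance_div_sq hS (mul_pos hn' hη)
  rw [hmean, hvar] at h
  refine (measure_mono fun x hx => ?_).trans (h.trans_eq ?_)
  · simp only [mem_ofPred_eq, Finset.sum_apply] at hx ⊢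
    have : ∑ i, g (x i) - n * ∫ y, g y ∂ν = n * ((∑ i, g (x i)) / n - ∫ y, g y ∂ν) := by
      field_simp
    rw [this, abs_mul, abs_of_pos hn']
    gcongr
  · congr 1
    simp only [Finset.sum_const, Finset.card_univ, Fintype.card_fin, nsmul_eq_mul]
    field_simp

/-- Density of the exponentially tilted and rescaled version of `μ_p`. -/
def tiltDens (p s r y : ℝ) : ℝ := r / mgfP p s * (densP p (r * y) * Real.exp (s * (r * y)))

lemma tiltDens_nonneg {p s r : ℝ} (hp : 1 < p) (hr : 0 < r) (y : ℝ) : 0 ≤ tiltDens p s r y :=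
  mul_nonneg (div_pos hr (mgfP_pos hp s)).le
    (mul_nonneg (densP_pos hp _).le (Real.exp_pos _).le)

lemma measurable_tiltDens {p s r : ℝ} (hp : 1 < p) : Measurable (tiltDens p s r) := by
  have := measurable_densP hp
  unfold tiltDens
  fun_prop

/-- The exponentially tilted and rescaled version of `μ_p`. -/
def tiltP (p s r : ℝ) : Measure ℝ := volume.withDensity fun y => ENNReal.ofReal (tiltDens p s r y)

lemma integrable_tilt {p s r : ℝ} (hp : 1 < p) (hr : 0 < r) {g : ℝ → ℝ}
    (hg : Integrable (fun x => g (x / r) * Real.exp (s * x)) (muP p)) :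
    Integrable g (tiltP p s r) := by
  rw [tiltP, integrable_withDensity_iff_integrable_smul'
    (measurable_tiltDens hp).ennreal_ofReal (ae_of_all _ fun _ => ENNReal.ofReal_lt_top)]
  have h := (((integrable_muP_iff hp).1 hg).comp_mul_left' hr.ne').const_mul (r / mgfP p s)
  refine h.congr (ae_of_all _ fun y => ?_)
  simp only [smul_eq_mul]
  rw [ENNReal.toReal_ofReal (tiltDens_nonneg hp hr y), mul_div_cancel_left₀ _ hr.ne', tiltDens]
  ring

lemma integral_tilt {p s r : ℝ} (hp : 1 < p) (hr : 0 < r) (g : ℝ → ℝ) :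
    ∫ y, g y ∂(tiltP p s r) = (∫ x, g (x / r) * Real.exp (s * x) ∂(muP p)) / mgfP p s := by
  rw [tiltP, integral_withDensity_eq_integral_toReal_smul
    (measurable_tiltDens hp).ennreal_ofReal (ae_of_all _ fun _ => ENNReal.ofReal_lt_top)]
  have h := Measure.integral_comp_mul_left
    (fun x => densP p x * (g (x / r) * Real.exp (s * x))) r
  rw [integral_muP hp]
  have h2 : ∀ y, (ENNReal.ofReal (tiltDens p s r y)).toReal • g y
      = r / mgfP p s * (densP p (r * y) * (g (r * y / r) * Real.exp (s * (r * y)))) := fun y => by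
    rw [ENNReal.toReal_ofReal (tiltDens_nonneg hp hr y), mul_div_cancel_left₀ _ hr.ne', tiltDens,
      smul_eq_mul]
    ring
  simp_rw [h2]
  have h3 : r / mgfP p s * r⁻¹ = 1 / mgfP p s := by field_simp
  rw [integral_const_mul, h, abs_of_pos (inv_pos.2 hr), smul_eq_mul, ← mul_assoc, h3]
  ring

lemma integrable_tiltDens {p s r : ℝ} (hp : 1 < p) (hr : 0 < r) : Integrable (tiltDens p s r) :=
  (((integrable_muP_iff hp).1 (integrable_exp_muP hp s)).comp_mul_left' hr.ne').const_mul _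

lemma isProbabilityMeasure_tiltP {p s r : ℝ} (hp : 1 < p) (hr : 0 < r) :
    IsProbabilityMeasure (tiltP p s r) := by
  have := isFiniteMeasure_withDensity_ofReal (integrable_tiltDens (s := s) hp hr).2
  have hfin : IsFiniteMeasure (tiltP p s r) := this
  have h := integral_tilt (s := s) hp hr fun _ => 1
  simp only [one_mul, integral_const, smul_eq_mul, mul_one] at h
  change _ = mgfP p s / mgfP p s at h
  rw [div_self (mgfP_pos hp s).ne'] at h
  refine ⟨?_⟩
  rw [← ENNReal.ofReal_toReal (measure_ne_top (tiltP p s r) univ)]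
  change (tiltP p s r).real univ = 1 at h
  rw [measureReal_def] at h
  simp [h]

lemma integral_id_tiltP {p s r : ℝ} (hp : 1 < p) (hr : 0 < r) :
    ∫ y, y ∂(tiltP p s r) = mgfP₁ p s / mgfP p s / r := by
  rw [integral_tilt hp hr, mgfP₁]
  simp_rw [div_mul_eq_mul_div]
  rw [integral_div]; ring

lemma integral_abs_rpow_tiltP {p s r : ℝ} (hp : 1 < p) (hr : 0 < r) :
    ∫ y, |y| ^ p ∂(tiltP p s r) = mgfPabs p s / mgfP p s / r ^ p := by
  rw [integral_tilt hp hr, mgfPabs]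
  simp_rw [abs_div, abs_of_pos hr, Real.div_rpow (abs_nonneg _) hr.le, div_mul_eq_mul_div]
  rw [integral_div]; ring

lemma memLp_id_tiltP {p s r : ℝ} (hp : 1 < p) (hr : 0 < r) :
    MemLp (fun y : ℝ => y) 2 (tiltP p s r) := by
  rw [memLp_two_iff_integrable_sq (by fun_prop)]
  refine integrable_tilt hp hr ?_
  refine ((integrable_abs_rpow_exp_muP hp zero_le_two s).div_const (r ^ 2)).congr
    (ae_of_all _ fun y => ?_)
  simp [div_pow]; ring

lemma memLp_abs_rpow_tiltP {p s r : ℝ} (hp : 1 < p) (hr : 0 < r) :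
    MemLp (fun y : ℝ => |y| ^ p) 2 (tiltP p s r) := by
  rw [memLp_two_iff_integrable_sq
    (Measurable.aestronglyMeasurable (f := fun y : ℝ => |y| ^ p) (by fun_prop))]
  refine integrable_tilt hp hr ?_
  refine ((integrable_abs_rpow_exp_muP hp (k := p * 2) (by linarith) s).div_const
    (r ^ (p * 2))).congr (ae_of_all _ fun y => ?_)
  simp only
  rw [← Real.rpow_mul_natCast (abs_nonneg _), abs_div, abs_of_pos hr,
    Real.div_rpow (abs_nonneg _) hr.le]
  push_cast; ring

lemma tiltDens_eq_exp {p s r : ℝ} (hp : 1 < p) (hr : 0 < r) (y : ℝ) :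
    tiltDens p s r y = Real.exp
      (Real.log r - cgfP p s - Real.log (normZ p) + s * r * y - r ^ p / p * |y| ^ p) := by
  rw [tiltDens, densP, cgfP, abs_mul, abs_of_pos hr, Real.mul_rpow hr.le (abs_nonneg _),
    show Real.log r - Real.log (mgfP p s) - Real.log (normZ p) + s * r * y - r ^ p / p * |y| ^ p
      = Real.log r - Real.log (mgfP p s) - Real.log (normZ p)
        + (-(r ^ p * |y| ^ p) / p + s * (r * y)) by ring,
    Real.exp_add, Real.exp_add, Real.exp_sub, Real.exp_sub, Real.exp_log hr,
    Real.exp_log (mgfP_pos hp s), Real.exp_log (normZ_pos hp)]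
  ring

lemma prod_tiltDens {p s r : ℝ} (hp : 1 < p) (hr : 0 < r) {n : ℕ} (y : Fin n → ℝ) :
    ∏ i, tiltDens p s r (y i) = Real.exp
      (n * (Real.log r - cgfP p s - Real.log (normZ p)) + s * r * ∑ i, y i
        - r ^ p / p * ∑ i, |y i| ^ p) := by
  simp_rw [tiltDens_eq_exp hp hr]
  rw [← Real.exp_sum, Finset.sum_sub_distrib, Finset.sum_add_distrib, Finset.mul_sum,
    Finset.mul_sum]
  simp only [Finset.sum_const, Finset.card_univ, Fintype.card_fin, nsmul_eq_mul]

/-- The points of the `ℓ^p` ball of radius `n^{1/p}` whose coordinate average lies in `U`. -/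
def ballSlab (n : ℕ) (p : ℝ) (U : Set ℝ) : Set (Fin n → ℝ) :=
  {y | ∑ i, |y i| ^ p ≤ n ∧ (∑ i, y i) / n ∈ U}

lemma measurableSet_ballSlab (n : ℕ) (p : ℝ) {U : Set ℝ} (hU : MeasurableSet U) :
    MeasurableSet (ballSlab n p U) := by
  have h1 : Measurable fun y : Fin n → ℝ => ∑ i, |y i| ^ p := by fun_prop
  have h2 : Measurable fun y : Fin n → ℝ => (∑ i, y i) / n := by fun_prop
  exact (measurableSet_le h1 measurable_const).inter (h2 hU)

lemma lintegral_prod_tiltDens {p s r : ℝ} (hp : 1 < p) (hr : 0 < r) (n : ℕ) :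
    ∫⁻ y : Fin n → ℝ, ENNReal.ofReal (∏ i, tiltDens p s r (y i)) = 1 := by
  rw [lintegral_ofReal_prod (fun _ => integrable_tiltDens hp hr)
    fun _ => tiltDens_nonneg hp hr]
  have := isProbabilityMeasure_tiltP (s := s) hp hr
  have h : ∫⁻ y, ENNReal.ofReal (tiltDens p s r y) = 1 := by
    rw [← setLIntegral_univ, ← withDensity_apply _ MeasurableSet.univ]
    exact measure_univ (μ := tiltP p s r)
  simp [h]

lemma ofReal_exp_mul_ofReal_exp_neg (x : ℝ) :
    ENNReal.ofReal (Real.exp x) * ENNReal.ofReal (Real.exp (-x)) = 1 := by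
  rw [← ENNReal.ofReal_mul (Real.exp_pos _).le, ← Real.exp_add]
  simp

lemma volume_ballSlab_le {p s r a : ℝ} (hp : 1 < p) (hr : 0 < r) {n : ℕ} (hn : 0 < n)
    {U : Set ℝ} (hU : MeasurableSet U) (ha : ∀ x ∈ U, s * a ≤ s * x) :
    volume (ballSlab n p U) ≤ ENNReal.ofReal
      (Real.exp (n * (Real.log (normZ p) + 1 / p - rateQ p (cgfP p) a s r))) := by
  have hn' : (0 : ℝ) < n := by exact_mod_cast hn
  set c : ℝ := n * (Real.log (normZ p) + 1 / p - rateQ p (cgfP p) a s r) with hc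
  have hlow : ∀ y ∈ ballSlab n p U,
      ENNReal.ofReal (Real.exp (-c)) ≤ ENNReal.ofReal (∏ i, tiltDens p s r (y i)) := by
    rintro y ⟨h1, h2⟩
    refine ENNReal.ofReal_le_ofReal ?_
    rw [prod_tiltDens hp hr]
    refine Real.exp_le_exp.2 ?_
    have h3 : s * a * n ≤ s * ∑ i, y i := by
      calc s * a * n ≤ s * ((∑ i, y i) / n) * n := mul_le_mul_of_nonneg_right (ha _ h2) hn'.le
        _ = s * ∑ i, y i := by field_simp
    have h4 : r ^ p / p * ∑ i, |y i| ^ p ≤ r ^ p / p * n := by gcongr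
    have h5 := mul_le_mul_of_nonneg_right h3 hr.le
    rw [hc, rateQ]
    have : (1 - r ^ p) / p = 1 / p - r ^ p / p := by ring
    rw [this]
    nlinarith
  have hmul : ENNReal.ofReal (Real.exp (-c)) * volume (ballSlab n p U) ≤ 1 := by
    rw [← setLIntegral_const, ← lintegral_prod_tiltDens (s := s) hp hr n]
    exact (setLIntegral_mono' (measurableSet_ballSlab n p hU) hlow).trans
      (setLIntegral_le_lintegral _ _)
  calc volume (ballSlab n p U)
      = ENNReal.ofReal (Real.exp c)
        * (ENNReal.ofReal (Real.exp (-c)) * volume (ballSlab n p U)) := by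
        rw [← mul_assoc, ofReal_exp_mul_ofReal_exp_neg, one_mul]
    _ ≤ ENNReal.ofReal (Real.exp c) * 1 := by gcongr
    _ = _ := mul_one _

lemma eventually_half_le_pi_tiltP {p s r η : ℝ} (hp : 1 < p) (hr : 0 < r) (hη : 0 < η) :
    ∀ᶠ n : ℕ in atTop, ENNReal.ofReal (1 / 2) ≤ Measure.pi (fun _ : Fin n => tiltP p s r)
      {y | |(∑ i, y i) / n - mgfP₁ p s / mgfP p s / r| < η ∧
        |(∑ i, |y i| ^ p) / n - mgfPabs p s / mgfP p s / r ^ p| < η} := by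
  have := isProbabilityMeasure_tiltP (s := s) hp hr
  have h1 := tendsto_pi_deviation (memLp_id_tiltP (s := s) hp hr) hη
  have h2 := tendsto_pi_deviation (memLp_abs_rpow_tiltP (s := s) hp hr) hη
  rw [integral_id_tiltP hp hr] at h1
  rw [integral_abs_rpow_tiltP hp hr] at h2
  have h3 := h1.add h2
  rw [add_zero] at h3
  filter_upwards [h3.eventually_le_const (u := ENNReal.ofReal (1 / 2)) (by simp)] with n hn
  set A := {x : Fin n → ℝ | η ≤ |(∑ i, x i) / n - mgfP₁ p s / mgfP p s / r|}
  set B := {x : Fin n → ℝ | η ≤ |(∑ i, |x i| ^ p) / n - mgfPabs p s / mgfP p s / r ^ p|}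
  have hA : MeasurableSet A := measurableSet_le measurable_const (by fun_prop)
  have hB : MeasurableSet B := measurableSet_le measurable_const (by fun_prop)
  have hset : {y : Fin n → ℝ | |(∑ i, y i) / n - mgfP₁ p s / mgfP p s / r| < η ∧
      |(∑ i, |y i| ^ p) / n - mgfPabs p s / mgfP p s / r ^ p| < η} = (A ∪ B)ᶜ := by
    ext y; simp [A, B]
  rw [hset, prob_compl_eq_one_sub (hA.union hB)]
  have h4 := (measure_union_le A B).trans hn
  calc ENNReal.ofReal (1 / 2) = 1 - ENNReal.ofReal (1 / 2) := by
        rw [← ENNReal.ofReal_one, ← ENNReal.ofReal_sub _ (by norm_num)]; norm_num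
    _ ≤ _ := tsub_le_tsub_left h4 _

lemma eventually_le_volume_ballSlab {p s r w ε η₀ : ℝ} (hp : 1 < p) (hw : w ∈ Ioo (-1 : ℝ) 1)
    (hr : 0 < r) (h₁ : mgfPabs p s / mgfP p s = r ^ p) (h₂ : mgfP₁ p s / mgfP p s = r * w)
    (hε : 0 < ε) (hη₀ : 0 < η₀) :
    ∀ᶠ n : ℕ in atTop, ENNReal.ofReal (1 / 2 * Real.exp
        (n * (Real.log (normZ p) + 1 / p - rateQ p (cgfP p) w s r - ε)))
      ≤ volume (ballSlab n p (Ioo (w - η₀) (w + η₀))) := by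
  have hp0 : 0 < p := by linarith
  set x := min (ε / 2) (η₀ / 2) with hx
  have hx0 : 0 < x := by positivity
  have hx1 : x ≤ ε / 2 := min_le_left _ _
  have hx2 : x ≤ η₀ / 2 := min_le_right _ _
  set θ := Real.exp (-x) with hθ
  have hθ0 : 0 < θ := Real.exp_pos _
  have hθ1 : θ < 1 := Real.exp_lt_one_iff.2 (by linarith)
  have hθx : 1 - x ≤ θ := by have := Real.add_one_le_exp (-x); linarith
  have hθp : θ ^ p < 1 := Real.rpow_lt_one hθ0.le hθ1 hp0
  set r' := r / θ with hr'
  have hr'0 : 0 < r' := div_pos hr hθ0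
  have hr'p : 0 < r' ^ p := Real.rpow_pos_of_pos hr'0 p
  set D := |s| * r' + r' ^ p / p + 1 with hD
  have hD0 : 0 < D := by positivity
  set η := min (η₀ / 2) (min (1 - θ ^ p) (ε / 2 / D)) with hη
  have hη0 : 0 < η := by
    refine lt_min (by linarith) (lt_min (by linarith) (by positivity))
  have hη1 : η ≤ η₀ / 2 := min_le_left _ _
  have hη2 : η ≤ 1 - θ ^ p := (min_le_right _ _).trans (min_le_left _ _)
  have hη3 : η * D ≤ ε / 2 := by
    rw [← le_div_iff₀ hD0]; exact (min_le_right _ _).trans (min_le_right _ _)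
  have hrr : r = r' * θ := by rw [hr']; field_simp
  have hm1 : mgfP₁ p s / mgfP p s / r' = θ * w := by
    rw [h₂, hrr]; field_simp
  have hm2 : mgfPabs p s / mgfP p s / r' ^ p = θ ^ p := by
    rw [h₁, hrr, Real.mul_rpow hr'0.le hθ0.le]; field_simp
  have hlog : Real.log r' = Real.log r + x := by
    rw [hr', Real.log_div hr.ne' hθ0.ne', hθ, Real.log_exp]; ring
  have hwθ : |θ * w - w| ≤ η₀ / 2 := by
    have : |w| < 1 := abs_lt.2 hw
    rw [show θ * w - w = -((1 - θ) * w) by ring, abs_neg, abs_mul,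
      abs_of_pos (by linarith : 0 < 1 - θ)]
    nlinarith [abs_nonneg w]
  filter_upwards [eventually_half_le_pi_tiltP (s := s) hp hr'0 hη0, eventually_gt_atTop 0]
    with n hn hnpos
  have hn' : (0 : ℝ) < n := by exact_mod_cast hnpos
  rw [hm1, hm2] at hn
  set T := {y : Fin n → ℝ | |(∑ i, y i) / n - θ * w| < η ∧ |(∑ i, |y i| ^ p) / n - θ ^ p| < η}
    with hT
  have hTm : MeasurableSet T :=
    (measurableSet_lt (f := fun y : Fin n → ℝ => |(∑ i, y i) / n - θ * w|) (by fun_prop)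
      measurable_const).inter
    (measurableSet_lt (f := fun y : Fin n → ℝ => |(∑ i, |y i| ^ p) / n - θ ^ p|) (by fun_prop)
      measurable_const)
  have hsub : T ⊆ ballSlab n p (Ioo (w - η₀) (w + η₀)) := by
    rintro y ⟨hy1, hy2⟩
    rw [abs_lt] at hy1 hy2
    rw [abs_le] at hwθ
    refine ⟨?_, by linarith, by linarith⟩
    have : (∑ i, |y i| ^ p) / n ≤ 1 := by linarith
    rwa [div_le_one hn'] at this
  set c : ℝ := n * (Real.log (normZ p) + 1 / p - rateQ p (cgfP p) w s r - ε) with hc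
  have hup : ∀ y ∈ T, ENNReal.ofReal (∏ i, tiltDens p s r' (y i))
      ≤ ENNReal.ofReal (Real.exp (-c)) := by
    rintro y ⟨hy1, hy2⟩
    refine ENNReal.ofReal_le_ofReal ?_
    rw [prod_tiltDens hp hr'0]
    refine Real.exp_le_exp.2 ?_
    set S := (∑ i, y i) / n with hS
    set V := (∑ i, |y i| ^ p) / n with hV
    have eS : ∑ i, y i = n * S := by rw [hS]; field_simp
    have eV : ∑ i, |y i| ^ p = n * V := by rw [hV]; field_simp
    have b1 : s * r' * (S - θ * w) ≤ |s| * r' * η := by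
      calc s * r' * (S - θ * w) ≤ |s * r' * (S - θ * w)| := le_abs_self _
        _ = |s| * r' * |S - θ * w| := by rw [abs_mul, abs_mul, abs_of_pos hr'0]
        _ ≤ _ := by gcongr
    have b2 : r' ^ p / p * (θ ^ p - V) ≤ r' ^ p / p * η := by
      gcongr; rw [abs_lt] at hy2; linarith
    have e3 : r' ^ p * θ ^ p = r ^ p := by rw [hrr, Real.mul_rpow hr'0.le hθ0.le]
    rw [eS, eV, hc, rateQ, hlog]
    have key : Real.log r + x - cgfP p s - Real.log (normZ p) + s * r' * S - r' ^ p / p * V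
        ≤ -(Real.log (normZ p) + 1 / p
          - (s * r * w + (1 - r ^ p) / p + Real.log r - cgfP p s) - ε) := by
      have e4 : s * r * w = s * r' * (θ * w) := by rw [hrr]; ring
      have e5 : (1 - r ^ p) / p = 1 / p - r' ^ p / p * θ ^ p := by rw [← e3]; ring
      rw [e4, e5]
      have : η * D = |s| * r' * η + r' ^ p / p * η + η := by rw [hD]; ring
      nlinarith
    calc _ = n * (Real.log r + x - cgfP p s - Real.log (normZ p) + s * r' * S
          - r' ^ p / p * V) := by ring
      _ ≤ n * -(Real.log (normZ p) + 1 / p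
          - (s * r * w + (1 - r ^ p) / p + Real.log r - cgfP p s) - ε) := by gcongr
      _ = _ := by ring
  have hpi : Measure.pi (fun _ : Fin n => tiltP p s r') T
      ≤ ENNReal.ofReal (Real.exp (-c)) * volume T := by
    rw [← setLIntegral_const]
    unfold tiltP
    rw [pi_withDensity_ofReal (integrable_tiltDens hp hr'0) (tiltDens_nonneg hp hr'0),
      withDensity_apply _ hTm]
    exact setLIntegral_mono' hTm hup
  calc ENNReal.ofReal (1 / 2 * Real.exp c)
      = ENNReal.ofReal (Real.exp c) * ENNReal.ofReal (1 / 2) := by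
        rw [mul_comm, ENNReal.ofReal_mul (Real.exp_pos _).le]
    _ ≤ ENNReal.ofReal (Real.exp c) * (ENNReal.ofReal (Real.exp (-c)) * volume T) := by
        gcongr; exact hn.trans hpi
    _ = volume T := by rw [← mul_assoc, ofReal_exp_mul_ofReal_exp_neg, one_mul]
    _ ≤ _ := measure_mono hsub

/-- The relative volume of a slab of the `ℓ^p` ball of radius `n^{1/p}`. -/
def slabProb (n : ℕ) (p : ℝ) (U : Set ℝ) : ℝ≥0∞ :=
  volume (ballSlab n p U) / volume (ballSlab n p univ)

lemma volume_lpBall_slab {p : ℝ} (hp : 1 < p) {n : ℕ} (hn : 0 < n) :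
    ∃ k : ℝ≥0∞, k ≠ 0 ∧ k ≠ ⊤ ∧ ∀ U : Set ℝ,
      volume ({x | (n : ℝ) ^ (1/p - 1/2 : ℝ) *
        dotp x (fun _ : Fin n => (n : ℝ) ^ (-(1:ℝ)/2)) ∈ U} ∩ lpBall n p)
      = k * volume (ballSlab n p U) := by
  have hn' : (0 : ℝ) < n := by exact_mod_cast hn
  have hp0 : 0 < p := by linarith
  set c : ℝ := (n : ℝ) ^ (1 / p) with hc
  have hc0 : 0 < c := Real.rpow_pos_of_pos hn' _
  have hcp : c ^ p = n := by
    rw [hc, ← Real.rpow_mul hn'.le, one_div_mul_cancel hp0.ne', Real.rpow_one]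
  refine ⟨ENNReal.ofReal |(c ^ Module.finrank ℝ (Fin n → ℝ))⁻¹|, ?_, ENNReal.ofReal_ne_top, ?_⟩
  · have : 0 < |(c ^ Module.finrank ℝ (Fin n → ℝ))⁻¹| := by positivity
    exact (ENNReal.ofReal_pos.2 this).ne'
  · intro U
    rw [← Measure.addHaar_preimage_smul volume hc0.ne']
    congr 1
    ext x
    have e1 : ∑ i, |c * x i| ^ p = n * ∑ i, |x i| ^ p := by
      rw [Finset.mul_sum]
      refine Finset.sum_congr rfl fun i _ => ?_
      rw [abs_mul, abs_of_pos hc0, Real.mul_rpow hc0.le (abs_nonneg _), hcp]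
    have e2 : (n : ℝ) ^ (1/p - 1/2 : ℝ) * dotp x (fun _ : Fin n => (n : ℝ) ^ (-(1:ℝ)/2))
        = (∑ i, c * x i) / n := by
      rw [dotp, ← Finset.sum_mul, ← Finset.mul_sum]
      have : (n : ℝ) ^ (1/p - 1/2 : ℝ) * (n : ℝ) ^ (-(1:ℝ)/2) = c / n := by
        rw [← Real.rpow_add hn', show 1/p - 1/2 + -(1:ℝ)/2 = 1/p - 1 by ring,
          Real.rpow_sub_one hn'.ne']
      rw [mul_left_comm, this]; ring
    simp only [mem_inter_iff, mem_ofPred_eq, lpBall, ballSlab, mem_preimage, Pi.smul_apply,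
      smul_eq_mul, e1, e2]
    rw [and_comm]
    refine and_congr_left fun _ => ?_
    rw [mul_le_iff_le_one_right hn']

lemma map_uniform_eq_slabProb {p : ℝ} (hp : 1 < p) {n : ℕ} (hn : 0 < n)
    {Ω : Type*} [MeasurableSpace Ω] {P : Measure Ω} {X : Ω → Fin n → ℝ} (hXm : Measurable X)
    (hX : Measure.map X P = uniformLpBall n p) {U : Set ℝ} (hU : MeasurableSet U) :
    P {ω | (n : ℝ) ^ (1/p - 1/2 : ℝ) *
        dotp (X ω) (fun _ : Fin n => (n : ℝ) ^ (-(1:ℝ)/2)) ∈ U} = slabProb n p U := by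
  obtain ⟨k, hk0, hk, h⟩ := volume_lpBall_slab hp hn
  have hW : Measurable fun x : Fin n → ℝ => (n : ℝ) ^ (1/p - 1/2 : ℝ) *
      dotp x (fun _ : Fin n => (n : ℝ) ^ (-(1:ℝ)/2)) := by
    unfold dotp; fun_prop
  have h1 := Measure.map_apply (μ := P) hXm (hW hU)
  have h2 := h univ
  simp only [mem_univ, ofPred_true, univ_inter] at h2
  refine h1.symm.trans ?_
  rw [hX, uniformLpBall, Measure.smul_apply, Measure.restrict_apply (hW hU), slabProb,
    ← ENNReal.mul_div_mul_left _ _ hk0 hk, ← h, ← h2, smul_eq_mul, mul_comm]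
  rfl

lemma slabProb_union_le (n : ℕ) (p : ℝ) (U V : Set ℝ) :
    slabProb n p (U ∪ V) ≤ slabProb n p U + slabProb n p V := by
  rw [slabProb, slabProb, slabProb, ← ENNReal.add_div]
  gcongr
  refine (measure_mono ?_).trans (measure_union_le _ _)
  rintro y ⟨h1, h2 | h2⟩
  · exact Or.inl ⟨h1, h2⟩
  · exact Or.inr ⟨h1, h2⟩

lemma rateQ_sign_mul_abs {p a s r σ : ℝ} (hp : 1 < p) (hσ : |σ| = 1) (hr : 0 < r)
    (ha : 0 ≤ σ * a) :
    rateQ p (cgfP p) a s r ≤ rateQ p (cgfP p) a (σ * |s|) r := by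
  have hK : cgfP p (σ * |s|) = cgfP p s := by
    rw [← cgfP_abs hp (σ * |s|), abs_mul, abs_abs, hσ, one_mul, cgfP_abs hp]
  rw [rateQ, rateQ, hK]
  have h1 : s * a ≤ |s| * |a| := by rw [← abs_mul]; exact le_abs_self _
  have h2 : |a| = σ * a := by rw [← abs_of_nonneg ha, abs_mul, hσ, one_mul]
  rw [h2] at h1
  nlinarith

lemma eventually_slabProb_le {p a z σ : ℝ} (hp : 1 < p) {C : Set ℝ} (hC : MeasurableSet C)
    (hσ : |σ| = 1) (ha : 0 ≤ σ * a) (haC : ∀ x ∈ C, σ * a ≤ σ * x)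
    (hz : (z : EReal) < rateSup p (cgfP p) a) :
    ∀ᶠ n : ℕ in atTop, slabProb n p C ≤ ENNReal.ofReal (1 / 2 * Real.exp (n * (-z))) := by
  simp only [rateSup, lt_iSup_iff] at hz
  obtain ⟨s, r, hr, hz⟩ := hz
  have hz' : z < rateQ p (cgfP p) a (σ * |s|) r :=
    (EReal.coe_lt_coe_iff.1 hz).trans_le (rateQ_sign_mul_abs hp hσ hr ha)
  set q := rateQ p (cgfP p) a (σ * |s|) r with hq
  have hsC : ∀ x ∈ C, σ * |s| * a ≤ σ * |s| * x := fun x hx => by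
    have := mul_le_mul_of_nonneg_right (haC x hx) (abs_nonneg s)
    linarith
  have h0 : (0 : ℝ) ∈ Ioo (-1 : ℝ) 1 := by simp
  obtain ⟨s₀, r₀, hr₀, h₁, h₂, h₃⟩ := exists_rateSup_cgfP_eq hp h0
  have hq0 : rateQ p (cgfP p) 0 s₀ r₀ = 0 := by
    rw [rateSup_zero (by linarith) (cgfP_zero hp) (cgfP_nonneg hp)] at h₃
    exact_mod_cast h₃.symm
  have hlow := eventually_le_volume_ballSlab hp h0 hr₀ h₁ h₂ (half_pos (sub_pos.2 hz'))
    one_pos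
  have hexp : ∀ᶠ n : ℕ in atTop, Real.log 4 ≤ n * ((q - z) / 2) :=
    (tendsto_natCast_atTop_atTop.atTop_mul_const (half_pos (sub_pos.2 hz'))).eventually_ge_atTop _
  filter_upwards [hlow, hexp, eventually_gt_atTop 0] with n hn he hnpos
  rw [hq0] at hn
  set A := Real.log (normZ p) + 1 / p with hA
  have hup := volume_ballSlab_le hp hr hnpos hC hsC
  rw [← hq, ← hA] at hup
  refine ENNReal.div_le_of_le_mul (hup.trans ?_)
  calc ENNReal.ofReal (Real.exp (n * (A - q)))
      ≤ ENNReal.ofReal (1 / 2 * Real.exp (n * (-z)) *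
          (1 / 2 * Real.exp (n * (A - 0 - (q - z) / 2)))) := by
        refine ENNReal.ofReal_le_ofReal ?_
        have e4 : (1 : ℝ) / 4 = Real.exp (-Real.log 4) := by
          rw [Real.exp_neg, Real.exp_log (by norm_num)]; norm_num
        have : 1 / 2 * Real.exp (n * (-z)) * (1 / 2 * Real.exp (n * (A - 0 - (q - z) / 2)))
            = 1 / 4 * (Real.exp (n * (-z)) * Real.exp (n * (A - 0 - (q - z) / 2))) := by ring
        rw [this, e4, ← Real.exp_add, ← Real.exp_add]
        refine Real.exp_le_exp.2 ?_
        nlinarith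
    _ = ENNReal.ofReal (1 / 2 * Real.exp (n * (-z))) *
          ENNReal.ofReal (1 / 2 * Real.exp (n * (A - 0 - (q - z) / 2))) :=
        ENNReal.ofReal_mul (by positivity)
    _ ≤ _ := by
        gcongr
        exact hn.trans (measure_mono fun y hy => ⟨hy.1, mem_univ _⟩)

lemma eventually_le_slabProb {p w z : ℝ} (hp : 1 < p) (hw : w ∈ Ioo (-1 : ℝ) 1) {G : Set ℝ}
    (hG : IsOpen G) (hwG : w ∈ G) (hz : rateSup p (cgfP p) w < z) :
    ∀ᶠ n : ℕ in atTop, ENNReal.ofReal (Real.exp (n * (-z))) ≤ slabProb n p G := by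
  obtain ⟨s, r, hr, h₁, h₂, h₃⟩ := exists_rateSup_cgfP_eq hp hw
  rw [h₃, EReal.coe_lt_coe_iff] at hz
  set q := rateQ p (cgfP p) w s r with hq
  obtain ⟨η, hη, hηG⟩ := Metric.isOpen_iff.1 hG w hwG
  rw [Real.ball_eq_Ioo] at hηG
  have hlow := eventually_le_volume_ballSlab hp hw hr h₁ h₂ (half_pos (sub_pos.2 hz)) hη
  have hexp : ∀ᶠ n : ℕ in atTop, Real.log 2 ≤ n * ((z - q) / 2) :=
    (tendsto_natCast_atTop_atTop.atTop_mul_const (half_pos (sub_pos.2 hz))).eventually_ge_atTop _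
  filter_upwards [hlow, hexp, eventually_gt_atTop 0] with n hn he hnpos
  have hup := volume_ballSlab_le (s := 0) (a := 0) hp one_pos hnpos MeasurableSet.univ (by simp)
  have hq0 : rateQ p (cgfP p) 0 0 1 = 0 := by simp [rateQ, cgfP_zero hp]
  set A := Real.log (normZ p) + 1 / p with hA
  rw [hq0] at hup
  rw [← hq] at hn
  have hfin : volume (ballSlab n p univ) ≠ ⊤ := ne_top_of_le_ne_top ENNReal.ofReal_ne_top hup
  have hmono : volume (ballSlab n p (Ioo (w - η) (w + η))) ≤ volume (ballSlab n p G) :=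
    measure_mono fun y hy => ⟨hy.1, hηG hy.2⟩
  have hpos : volume (ballSlab n p univ) ≠ 0 := by
    have h := hn.trans (hmono.trans
      (measure_mono (t := ballSlab n p univ) fun y hy => ⟨hy.1, mem_univ _⟩))
    exact ((ENNReal.ofReal_pos.2 (by positivity)).trans_le h).ne'
  rw [slabProb, ENNReal.le_div_iff_mul_le (Or.inl hpos) (Or.inl hfin)]
  calc ENNReal.ofReal (Real.exp (n * (-z))) * volume (ballSlab n p univ)
      ≤ ENNReal.ofReal (Real.exp (n * (-z))) * ENNReal.ofReal (Real.exp (n * (A - 0))) := by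
        gcongr
    _ = ENNReal.ofReal (Real.exp (n * (-z)) * Real.exp (n * (A - 0))) :=
        (ENNReal.ofReal_mul (Real.exp_pos _).le).symm
    _ ≤ ENNReal.ofReal (1 / 2 * Real.exp (n * (A - q - (z - q) / 2))) := by
        refine ENNReal.ofReal_le_ofReal ?_
        have e2 : (1 : ℝ) / 2 = Real.exp (-Real.log 2) := by
          rw [Real.exp_neg, Real.exp_log (by norm_num)]; norm_num
        rw [e2, ← Real.exp_add, ← Real.exp_add]
        refine Real.exp_le_exp.2 ?_
        nlinarith
    _ ≤ _ := hn.trans hmono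

lemma log_ofReal_exp (x : ℝ) : ENNReal.log (ENNReal.ofReal (Real.exp x)) = (x : EReal) := by
  rw [ENNReal.log_ofReal_of_pos (Real.exp_pos x), Real.log_exp]

lemma inv_mul_log_ofReal_exp {n : ℕ} (hn : 0 < n) (c : ℝ) :
    (((n : ℝ)⁻¹ : ℝ) : EReal) * ENNReal.log (ENNReal.ofReal (Real.exp (n * c))) = c := by
  have hn' : (n : ℝ) ≠ 0 := by exact_mod_cast hn.ne'
  rw [log_ofReal_exp, ← EReal.coe_mul, inv_mul_cancel_left₀ hn']

lemma inv_mul_log_mono (n : ℕ) {x y : ℝ≥0∞} (h : x ≤ y) :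
    (((n : ℝ)⁻¹ : ℝ) : EReal) * ENNReal.log x ≤ (((n : ℝ)⁻¹ : ℝ) : EReal) * ENNReal.log y :=
  mul_le_mul_of_nonneg_left (ENNReal.log_monotone h) (EReal.coe_nonneg.2 (by positivity))

lemma eventually_slabProb_le_of_closed {p z σ : ℝ} (hp : 1 < p) {C : Set ℝ} (hC : IsClosed C)
    (hσ : |σ| = 1) (hC0 : ∀ x ∈ C, 0 ≤ σ * x) (hz : ∀ x ∈ C, (z : EReal) < rateSup p (cgfP p) x) :
    ∀ᶠ n : ℕ in atTop, slabProb n p C ≤ ENNReal.ofReal (1 / 2 * Real.exp (n * (-z))) := by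
  rcases C.eq_empty_or_nonempty with rfl | hne
  · simp [slabProb, ballSlab]
  · obtain ⟨a, haC, ha⟩ := hC.exists_infDist_eq_dist hne 0
    have habs : ∀ x ∈ C, σ * x = |x| := fun x hx => by
      rw [← abs_of_nonneg (hC0 x hx), abs_mul, hσ, one_mul]
    refine eventually_slabProb_le hp hC.measurableSet hσ (hC0 a haC) (fun x hx => ?_) (hz a haC)
    rw [habs a haC, habs x hx]
    have := Metric.infDist_le_dist_of_mem (x := 0) hx
    rwa [ha, dist_zero_left, dist_zero_left, Real.norm_eq_abs, Real.norm_eq_abs] at this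

lemma exists_mem_Ioo_rateSup_le {p x : ℝ} (hp : 1 < p) {G : Set ℝ} (hG : IsOpen G) (hx : x ∈ G)
    (htop : rateSup p (cgfP p) x ≠ ⊤) :
    ∃ w ∈ G, w ∈ Ioo (-1 : ℝ) 1 ∧ rateSup p (cgfP p) w ≤ rateSup p (cgfP p) x := by
  have hx1 : |x| ≤ 1 := by
    by_contra! h
    exact htop (rateSup_cgfP_eq_top hp h)
  have hev : ∀ᶠ t : ℝ in 𝓝[<] 1, t * x ∈ G := by
    have : Tendsto (fun t : ℝ => t * x) (𝓝[<] 1) (𝓝 x) := by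
      have h : ContinuousAt (fun t : ℝ => t * x) 1 := by fun_prop
      have h' := h.tendsto
      rw [one_mul] at h'
      exact h'.mono_left nhdsWithin_le_nhds
    exact this (hG.mem_nhds hx)
  obtain ⟨t, htG, ht0, ht1⟩ := (hev.and (Ioo_mem_nhdsLT (zero_lt_one' ℝ))).exists
  refine ⟨t * x, htG, abs_lt.1 ?_, ?_⟩
  · rw [abs_mul, abs_of_pos ht0]
    nlinarith [abs_nonneg x]
  · have h0 : rateSup p (cgfP p) 0 ≤ rateSup p (cgfP p) x := by
      rw [rateSup_zero (by linarith) (cgfP_zero hp) (cgfP_nonneg hp)]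
      exact rateSup_nonneg (cgfP_zero hp) x
    have h := convex_rateSup_le p (cgfP p) (rateSup p (cgfP p) x) (x := x) (y := 0)
      (le_refl (rateSup p (cgfP p) x)) h0
      ht0.le (sub_nonneg.2 ht1.le) (by ring)
    simpa using h

lemma isLDP_rateSup {p : ℝ} (hp : 1 < p) {Ω : Type*} [MeasurableSpace Ω] {P : Measure Ω}
    {ξ : ℕ → Ω → ℝ}
    (h : ∀ n, 0 < n → ∀ U, MeasurableSet U → P {ω | ξ n ω ∈ U} = slabProb n p U) :
    IsLDP P ξ (fun n => (n : ℝ)) (rateSup p (cgfP p)) := by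
  refine ⟨lowerSemicontinuous_rateSup p _, fun Γ _ => ⟨?_, ?_⟩⟩
  · rw [EReal.neg_le]
    refine le_iInf₂ fun x hx => ?_
    by_cases htop : rateSup p (cgfP p) x = ⊤
    · rw [htop]; exact le_top
    obtain ⟨w, hwG, hw, hwx⟩ := exists_mem_Ioo_rateSup_le hp isOpen_interior hx htop
    refine le_trans (EReal.le_of_forall_lt_iff_le.1 fun z hz => ?_) hwx
    rw [EReal.neg_le]
    refine le_liminf_of_le (by isBoundedDefault) ?_
    filter_upwards [eventually_le_slabProb hp hw isOpen_interior hwG hz, eventually_gt_atTop 0]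
      with n hn hnpos
    rw [h n hnpos _ measurableSet_interior, ← EReal.coe_neg, ← inv_mul_log_ofReal_exp hnpos (-z)]
    exact inv_mul_log_mono n hn
  · rw [EReal.le_neg]
    refine EReal.ge_of_forall_gt_iff_ge.1 fun z hz => ?_
    rw [EReal.le_neg]
    have hzC : ∀ x ∈ closure Γ, (z : EReal) < rateSup p (cgfP p) x := fun x hx =>
      hz.trans_le (iInf₂_le x hx)
    have hpos := eventually_slabProb_le_of_closed (σ := 1) (C := closure Γ ∩ Ici 0) hp
      (isClosed_closure.inter isClosed_Ici) (by simp) (fun x hx => by simpa using hx.2)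
      fun x hx => hzC x hx.1
    have hneg := eventually_slabProb_le_of_closed (σ := -1) (C := closure Γ ∩ Iic 0) hp
      (isClosed_closure.inter isClosed_Iic) (by simp) (fun x hx => by simpa using hx.2)
      fun x hx => hzC x hx.1
    refine limsup_le_of_le (by isBoundedDefault) ?_
    filter_upwards [hpos, hneg, eventually_gt_atTop 0] with n h1 h2 hnpos
    rw [h n hnpos _ isClosed_closure.measurableSet, ← EReal.coe_neg,
      ← inv_mul_log_ofReal_exp hnpos (-z)]
    refine inv_mul_log_mono n ?_
    have hU : closure Γ = closure Γ ∩ Ici 0 ∪ closure Γ ∩ Iic 0 := by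
      rw [← inter_union_distrib_left, union_comm, Iic_union_Ici, inter_univ]
    calc slabProb n p (closure Γ)
        ≤ slabProb n p (closure Γ ∩ Ici 0) + slabProb n p (closure Γ ∩ Iic 0) := by
          conv_lhs => rw [hU]
          exact slabProb_union_le n p _ _
      _ ≤ ENNReal.ofReal (1 / 2 * Real.exp (n * (-z)))
          + ENNReal.ofReal (1 / 2 * Real.exp (n * (-z))) := add_le_add h1 h2
      _ = ENNReal.ofReal (Real.exp (n * (-z))) := by
          rw [← ENNReal.ofReal_add (by positivity) (by positivity)]
          congr 1; ring

end LDP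

/-- Atypicality of the diagonal direction `ι`, and comparison of rate functions. -/
theorem statement5
    (p : ℝ) (hp : 1 < p)
    {Ω : Type*} [MeasurableSpace Ω] (P : Measure Ω) [IsProbabilityMeasure P]
    (X : (n : ℕ) → Ω → (Fin n → ℝ))
    (hXmeas : ∀ n, Measurable (X n))
    (hX : ∀ n, 0 < n → Measure.map (X n) P = uniformLpBall n p) :
    IsLDP P
      (fun n ω => (n : ℝ) ^ (1/p - 1/2 : ℝ) *
        dotp (X n ω) (fun _ : Fin n => (n : ℝ) ^ (-(1:ℝ)/2)))
      (fun n => (n : ℝ)) (Icr p)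
    ∧ (∀ w : ℝ, 0 ≤ Icr p w)
    ∧ HasCompactSublevels (Icr p) ∧ QuasiconvexRate (Icr p) ∧ SymmetricRate (Icr p)
    ∧ (∀ w ∈ Set.Ioo (-1 : ℝ) 1,
        (2 < p → Icr p w ≤ Iq p (muP 2) w ∧ (Iq p (muP 2) w = Icr p w ↔ w = 0))
        ∧ (p = 2 → Iq p (muP 2) w = Icr p w)
        ∧ (p < 2 → Iq p (muP 2) w ≤ Icr p w ∧ (Iq p (muP 2) w = Icr p w ↔ w = 0))) := by
  refine ⟨?_, ?_, ?_, ?_, ?_, fun w hw => Iq_Icr_compare hp hw⟩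
  all_goals rw [show Icr p = rateSup p (cgfP p) from funext (Icr_eq hp)]
  · exact isLDP_rateSup hp fun n hn U hU => map_uniform_eq_slabProb hp hn (hXmeas n) (hX n hn) hU
  · exact rateSup_nonneg (cgfP_zero hp)
  · exact isCompact_rateSup_le p _
  · exact convex_rateSup_le p _
  · exact rateSup_neg (cgfP_neg hp)
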